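/- arXiv:1810.04980 — 5 statements merged into one kernel-verified Lean document; each statement's English description precedes it below -/
import Mathlib

section
/- For all positive integers n and k with n ≥ 3k, there exists an edge-colored complete graph G on n vertices using exactly n + k − 1 distinct colors on its edges (so that m(G) + c(G) = C(n+1,2) + k − 1) such that G contains exactly k rainbow triangles. -/
/-- A rainbow triangle in an edge-colored graph: three pairwise adjacent vertices
whose three connecting edges receive pairwise distinct colors. -/
def IsRainbowTriangle {V : Type*} (G : SimpleGraph V) (col : Sym2 V → ℕ)
    (a b c : V) : Prop :=
  G.Adj a b ∧ G.Adj b c ∧ G.Adj a c ∧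
    col s(a, b) ≠ col s(b, c) ∧ col s(a, b) ≠ col s(a, c) ∧
    col s(b, c) ≠ col s(a, c)

/-- The set of (vertex sets of) rainbow triangles of an edge-colored graph. -/
def rainbowTriangles {V : Type*} [DecidableEq V] (G : SimpleGraph V)
    (col : Sym2 V → ℕ) : Set (Finset V) :=
  {t | ∃ a b c, t = {a, b, c} ∧ IsRainbowTriangle G col a b c}

/-- Blocks: the first `3 * k` vertices are grouped into consecutive triples, every further vertex
is a block of its own. -/
def tripleBlock (k v : ℕ) : ℕ := if v < 3 * k then v / 3 else v - 2 * k

/-- An edge between two blocks is colored by the larger block; the edges inside the triples receive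
pairwise distinct further colors. -/
def tripleColor (n k u v : ℕ) : ℕ :=
  if tripleBlock k u = tripleBlock k v then n - 2 * k - 1 + (u + v - 3 * tripleBlock k u)
  else max (tripleBlock k u) (tripleBlock k v)

theorem tripleColor_comm (n k u v : ℕ) : tripleColor n k u v = tripleColor n k v u := by
  unfold tripleColor
  by_cases h : tripleBlock k u = tripleBlock k v
  · simp [h, add_comm]
  · simp [h, Ne.symm h, max_comm]

/-- The coloring `tripleColor` on unordered pairs of vertices. -/
def tripleColoring (n k : ℕ) : Sym2 (Fin n) → ℕ :=
  Sym2.lift ⟨fun u v => tripleColor n k u v, fun u v => tripleColor_comm n k u v⟩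

@[simp]
theorem tripleColoring_mk (n k : ℕ) (u v : Fin n) :
    tripleColoring n k s(u, v) = tripleColor n k u v := rfl

theorem tripleColor_mem_Icc {n k u v : ℕ} (h3k : 3 * k ≤ n) (hu : u < n) (hv : v < n)
    (h : u ≠ v) : tripleColor n k u v ∈ Set.Icc 1 (n + k - 1) := by
  simp only [tripleColor, tripleBlock, Set.mem_Icc]
  split_ifs <;> omega

theorem exists_tripleColor_eq {n k c : ℕ} (hk : 1 ≤ k) (h3k : 3 * k ≤ n)
    (hc : c ∈ Set.Icc 1 (n + k - 1)) :
    ∃ u v, u < n ∧ v < n ∧ u ≠ v ∧ tripleColor n k u v = c := by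
  obtain ⟨h1, h2⟩ := hc
  rcases lt_or_ge c (n - 2 * k) with h | h
  · refine ⟨0, if c < k then 3 * c else c + 2 * k, by omega, ?_, ?_, ?_⟩
    · split_ifs <;> omega
    · split_ifs <;> omega
    · simp only [tripleColor, tripleBlock]
      split_ifs <;> omega
  · obtain ⟨d, rfl⟩ := Nat.exists_eq_add_of_le h
    have hd : d < 3 * k := by omega
    refine ⟨3 * (d / 3) + d % 3 / 2, 3 * (d / 3) + (d % 3 + 3) / 2, ?_, ?_, ?_, ?_⟩
    · omega
    · omega
    · omega
    · simp only [tripleColor, tripleBlock]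
      split_ifs <;> omega

theorem image_tripleColoring {n k : ℕ} (hk : 1 ≤ k) (h3k : 3 * k ≤ n) :
    tripleColoring n k '' (⊤ : SimpleGraph (Fin n)).edgeSet = Set.Icc 1 (n + k - 1) := by
  ext c
  constructor
  · rintro ⟨e, he, rfl⟩
    induction e with
    | h u v =>
      have huv : u ≠ v := by simpa using he
      exact tripleColor_mem_Icc h3k u.2 v.2 (fun h => huv (Fin.ext h))
  · intro hc
    obtain ⟨u, v, hu, hv, huv, h⟩ := exists_tripleColor_eq hk h3k hc
    exact ⟨s(⟨u, hu⟩, ⟨v, hv⟩), by simpa using huv, h⟩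

/-- The vertices of the `b`-th triple. -/
def triple (n b : ℕ) : Finset (Fin n) := Finset.univ.filter fun v => v.1 / 3 = b

@[simp]
theorem mem_triple {n b : ℕ} {v : Fin n} : v ∈ triple n b ↔ v.1 / 3 = b := by
  simp [triple]

theorem triple_injective {n k : ℕ} (h3k : 3 * k ≤ n) :
    Function.Injective fun b : Fin k => triple n b := by
  intro b b' h
  have hb : 3 * b.1 < n := by omega
  have hmem : (⟨3 * b.1, hb⟩ : Fin n) ∈ triple n b' := by
    rw [← show triple n b = triple n b' from h]
    exact mem_triple.2 (by simp)
  have := mem_triple.1 hmem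
  simp only at this
  ext
  omega

theorem div_three_eq_of_rainbow {n k a b c : ℕ} (hab : a ≠ b) (hbc : b ≠ c) (hac : a ≠ c)
    (h1 : tripleColor n k a b ≠ tripleColor n k b c)
    (h2 : tripleColor n k a b ≠ tripleColor n k a c)
    (h3 : tripleColor n k b c ≠ tripleColor n k a c) :
    a < 3 * k ∧ b < 3 * k ∧ c < 3 * k ∧ b / 3 = a / 3 ∧ c / 3 = a / 3 := by
  have hblock : tripleBlock k a = tripleBlock k b ∧ tripleBlock k b = tripleBlock k c := by
    simp only [tripleColor] at h1 h2 h3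
    generalize tripleBlock k a = x at *
    generalize tripleBlock k b = y at *
    generalize tripleBlock k c = z at *
    split_ifs at h1 h2 h3 <;> omega
  obtain ⟨h, h'⟩ := hblock
  clear h1 h2 h3
  simp only [tripleBlock] at h h'
  split_ifs at h h' <;> omega

theorem rainbowTriangles_tripleColoring {n k : ℕ} (h3k : 3 * k ≤ n) :
    rainbowTriangles (⊤ : SimpleGraph (Fin n)) (tripleColoring n k) =
      Set.range fun b : Fin k => triple n b := by
  ext t
  constructor
  · rintro ⟨a, b, c, rfl, hab, hbc, hac, h1, h2, h3⟩
    simp only [SimpleGraph.top_adj, ne_eq, Fin.ext_iff] at hab hbc hac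
    obtain ⟨ha, hb, hc, h, h'⟩ := div_three_eq_of_rainbow hab hbc hac h1 h2 h3
    refine ⟨⟨a / 3, by omega⟩, ?_⟩
    ext v
    simp only [mem_triple, Finset.mem_insert, Finset.mem_singleton, Fin.ext_iff]
    omega
  · rintro ⟨b, rfl⟩
    have hb := b.2
    refine ⟨⟨3 * b, by omega⟩, ⟨3 * b + 1, by omega⟩, ⟨3 * b + 2, by omega⟩, ?_, ?_⟩
    · ext v
      simp only [mem_triple, Finset.mem_insert, Finset.mem_singleton, Fin.ext_iff]
      omega
    · have e0 : tripleBlock k (3 * b) = b := by unfold tripleBlock; split_ifs <;> omega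
      have e1 : tripleBlock k (3 * b + 1) = b := by unfold tripleBlock; split_ifs <;> omega
      have e2 : tripleBlock k (3 * b + 2) = b := by unfold tripleBlock; split_ifs <;> omega
      simp only [IsRainbowTriangle, SimpleGraph.top_adj, tripleColoring_mk, tripleColor, e0, e1, e2,
        if_true, ne_eq, Fin.ext_iff]
      omega


/-- For all positive integers `n, k` with `n ≥ 3k`, there is an edge-coloring of
the complete graph on `n` vertices using exactly `n + k - 1` distinct colors
(so that `m + c = (n+1 choose 2) + k - 1`) having exactly `k` rainbow triangles. -/
theorem stmt_2 (n k : ℕ) (hn : 1 ≤ n) (hk : 1 ≤ k) (h3k : 3 * k ≤ n) :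
    ∃ col : Sym2 (Fin n) → ℕ,
      (col '' (⊤ : SimpleGraph (Fin n)).edgeSet).ncard = n + k - 1 ∧
      (⊤ : SimpleGraph (Fin n)).edgeSet.ncard +
        (col '' (⊤ : SimpleGraph (Fin n)).edgeSet).ncard
        = (n + 1).choose 2 + k - 1 ∧
      (rainbowTriangles (⊤ : SimpleGraph (Fin n)) col).ncard = k := by
  have hcolors : (tripleColoring n k '' (⊤ : SimpleGraph (Fin n)).edgeSet).ncard = n + k - 1 := by
    rw [image_tripleColoring hk h3k, ← Finset.coe_Icc, Set.ncard_coe_finset, Nat.card_Icc]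
    omega
  have hedges : (⊤ : SimpleGraph (Fin n)).edgeSet.ncard = n.choose 2 := by
    rw [← SimpleGraph.coe_edgeFinset, Set.ncard_coe_finset,
      SimpleGraph.card_edgeFinset_top_eq_card_choose_two, Fintype.card_fin]
  refine ⟨tripleColoring n k, hcolors, ?_, ?_⟩
  · rw [hcolors, hedges, Nat.choose_succ_succ' n 1, Nat.choose_one_right, one_add_one_eq_two]
    omega
  · rw [rainbowTriangles_tripleColoring h3k, ← Set.image_univ,
      Set.ncard_image_of_injective _ (triple_injective h3k), Set.ncard_univ, Nat.card_fin]
end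

section
/- If G is an edge-colored graph on n vertices, m(G) + c(G) ≥ C(n+1,2) + k − 1 for a positive integer k, and G contains exactly k rainbow triangles, then m(G) + c(G) = C(n+1,2) + k − 1 and G is a complete graph. -/
/-- The colors of `G` that occur only on edges incident with `v`. -/
def saturatedColors {V : Type*} (G : SimpleGraph V) (col : Sym2 V → ℕ) (v : V) : Set ℕ :=
  (col '' G.edgeSet) \ (col '' (G.deleteIncidenceSet v).edgeSet)

lemma exists_adj_of_mem_saturatedColors {V : Type*} {G : SimpleGraph V} {col : Sym2 V → ℕ}
    {v : V} {κ : ℕ} (hκ : κ ∈ saturatedColors G col v) :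
    ∃ w, G.Adj v w ∧ col s(v, w) = κ := by
  obtain ⟨⟨e, he, rfl⟩, h2⟩ := hκ
  have hv : v ∈ e := by
    by_contra hv
    refine h2 ⟨e, ?_, rfl⟩
    rw [SimpleGraph.edgeSet_deleteIncidenceSet]
    exact ⟨he, fun h => hv h.2⟩
  obtain ⟨w, rfl⟩ := Sym2.mem_iff_exists.1 hv
  exact ⟨w, he, rfl⟩

lemma not_adj_of_saturatedColors {V : Type*} {G : SimpleGraph V} {col : Sym2 V → ℕ}
    (hfree : ∀ a b c, ¬ IsRainbowTriangle G col a b c) {v x y : V}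
    (hx : G.Adj v x) (hy : G.Adj v y) (hsx : col s(v, x) ∈ saturatedColors G col v)
    (hsy : col s(v, y) ∈ saturatedColors G col v) (hne : col s(v, x) ≠ col s(v, y)) :
    ¬ G.Adj x y := by
  intro hxy
  have hmem : col s(x, y) ∈ col '' (G.deleteIncidenceSet v).edgeSet := by
    refine ⟨_, ?_, rfl⟩
    rw [SimpleGraph.mem_edgeSet, SimpleGraph.deleteIncidenceSet_adj]
    exact ⟨hxy, hx.ne', hy.ne'⟩
  exact hfree v x y ⟨hx, hxy, hy, fun h => hsx.2 (h ▸ hmem), hne, fun h => hsy.2 (h ▸ hmem)⟩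

lemma ncard_saturatedColors_add_ncard_neighborSet_le {V : Type*} [Finite V]
    {G : SimpleGraph V} {col : Sym2 V → ℕ}
    (hfree : ∀ a b c, ¬ IsRainbowTriangle G col a b c) {S : Finset V}
    (hS : ∀ a b, G.Adj a b → a ∈ S) {v u : V} (hvu : G.Adj v u)
    (hsat : col s(v, u) ∈ saturatedColors G col v) :
    (saturatedColors G col v).ncard + (G.neighborSet u).ncard ≤ S.card := by
  have hrep : ∀ κ ∈ saturatedColors G col v, ∃ w, G.Adj v w ∧ col s(v, w) = κ ∧ ¬ G.Adj u w := by
    intro κ hκ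
    by_cases hc : col s(v, u) = κ
    · exact ⟨u, hvu, hc, G.loopless.irrefl u⟩
    · obtain ⟨w, hw, rfl⟩ := exists_adj_of_mem_saturatedColors hκ
      exact ⟨w, hw, rfl, not_adj_of_saturatedColors hfree hvu hw hsat hκ hc⟩
  have : Nonempty V := ⟨u⟩
  choose! f hf1 hf2 hf3 using hrep
  have hinj : Set.InjOn f (saturatedColors G col v) := by
    intro a ha b hb hab
    rw [← hf2 a ha, ← hf2 b hb, hab]
  have hdisj : Disjoint (f '' saturatedColors G col v) (G.neighborSet u) := by
    rw [Set.disjoint_left]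
    rintro _ ⟨κ, hκ, rfl⟩ h
    exact hf3 κ hκ h
  rw [← hinj.ncard_image, ← Set.ncard_union_eq hdisj (Set.toFinite _) (Set.toFinite _),
    ← Set.ncard_coe_finset]
  refine Set.ncard_le_ncard ?_ (Set.toFinite _)
  rintro x (⟨κ, hκ, rfl⟩ | hx)
  · exact hS _ _ (hf1 κ hκ).symm
  · exact hS _ _ (G.adj_symm hx)

lemma ncard_neighborSet_lt {V : Type*} {G : SimpleGraph V} {S : Finset V}
    (hS : ∀ a b, G.Adj a b → a ∈ S) {v : V} (hv : v ∈ S) :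
    (G.neighborSet v).ncard < S.card := by
  rw [← Set.ncard_coe_finset]
  refine Set.ncard_lt_ncard ⟨fun x hx => hS _ _ (G.adj_symm hx), fun h => ?_⟩ S.finite_toSet
  exact G.loopless.irrefl v (h hv)

lemma exists_ncard_neighborSet_add_ncard_saturatedColors_le {V : Type*} [Finite V]
    {G : SimpleGraph V} {col : Sym2 V → ℕ}
    (hfree : ∀ a b c, ¬ IsRainbowTriangle G col a b c) {S : Finset V} (hne : S.Nonempty)
    (hS : ∀ a b, G.Adj a b → a ∈ S) :
    ∃ u ∈ S, (G.neighborSet u).ncard + (saturatedColors G col u).ncard ≤ S.card := by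
  obtain ⟨v, hv, hmax⟩ := S.exists_max_image (fun v => (saturatedColors G col v).ncard) hne
  rcases (saturatedColors G col v).eq_empty_or_nonempty with h0 | ⟨κ, hκ⟩
  · refine ⟨v, hv, ?_⟩
    rw [h0, Set.ncard_empty]
    exact (ncard_neighborSet_lt hS hv).le
  · obtain ⟨u, hu, rfl⟩ := exists_adj_of_mem_saturatedColors hκ
    have huS := hS _ _ hu.symm
    refine ⟨u, huS, ?_⟩
    have h1 := ncard_saturatedColors_add_ncard_neighborSet_le hfree hS hu hκ
    have h2 := hmax u huS
    omega

lemma ncard_edgeSet_eq_deleteIncidenceSet {V : Type*} [Finite V] (G : SimpleGraph V) (u : V) :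
    G.edgeSet.ncard = (G.deleteIncidenceSet u).edgeSet.ncard + (G.neighborSet u).ncard := by
  classical
  rw [SimpleGraph.edgeSet_deleteIncidenceSet,
    ← Set.ncard_sdiff_add_ncard_of_subset (G.incidenceSet_subset u) (Set.toFinite _)]
  congr 1
  exact Nat.card_congr (G.incidenceSetEquivNeighborSet u)

lemma ncard_colors_eq_deleteIncidenceSet {V : Type*} [Finite V] (G : SimpleGraph V)
    (col : Sym2 V → ℕ) (u : V) :
    (col '' G.edgeSet).ncard =
      (col '' (G.deleteIncidenceSet u).edgeSet).ncard + (saturatedColors G col u).ncard := by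
  have hsub : col '' (G.deleteIncidenceSet u).edgeSet ⊆ col '' G.edgeSet :=
    Set.image_mono (SimpleGraph.edgeSet_mono (G.deleteIncidenceSet_le u))
  rw [← Set.ncard_sdiff_add_ncard_of_subset hsub (Set.toFinite _), add_comm]
  rfl

/-- A graph without rainbow triangles satisfies `m + c ≤ (n+1 choose 2) - 1`, and only complete
graphs attain equality. -/
lemma edges_add_colors_lt_of_rainbowTriangle_free {V : Type*} [Finite V] (col : Sym2 V → ℕ)
    (N : ℕ) : ∀ (S : Finset V) (G : SimpleGraph V), S.card = N + 1 →
      (∀ a b, G.Adj a b → a ∈ S) → (∀ a b c, ¬ IsRainbowTriangle G col a b c) →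
      G.edgeSet.ncard + (col '' G.edgeSet).ncard < (N + 2).choose 2 ∧
      (G.edgeSet.ncard + (col '' G.edgeSet).ncard + 1 = (N + 2).choose 2 →
        ∀ a ∈ S, ∀ b ∈ S, a ≠ b → G.Adj a b) := by
  classical
  induction N with
  | zero =>
    intro S G hcard hS _
    obtain ⟨x, rfl⟩ := Finset.card_eq_one.1 hcard
    have hG : G = ⊥ := by
      ext a b
      simp only [SimpleGraph.bot_adj, iff_false]
      intro hab
      have h1 := hS _ _ hab
      have h2 := hS _ _ hab.symm
      simp only [Finset.mem_singleton] at h1 h2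
      exact hab.ne (h1.trans h2.symm)
    subst hG
    simp only [Finset.mem_singleton]
    refine ⟨by simp, fun _ a ha b hb hab => (hab (ha.trans hb.symm)).elim⟩
  | succ N ih =>
    intro S G hcard hS hfree
    obtain ⟨u, hu, hle⟩ := exists_ncard_neighborSet_add_ncard_saturatedColors_le hfree
      (Finset.card_pos.1 (by omega)) hS
    have hmono := G.deleteIncidenceSet_le u
    obtain ⟨ih1, ih2⟩ := ih (S.erase u) (G.deleteIncidenceSet u)
      (by rw [Finset.card_erase_of_mem hu]; omega)
      (fun a b h => by
        rw [SimpleGraph.deleteIncidenceSet_adj] at h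
        exact Finset.mem_erase.2 ⟨h.2.1, hS _ _ h.1⟩)
      (fun a b c h => hfree a b c ⟨hmono h.1, hmono h.2.1, hmono h.2.2.1, h.2.2.2⟩)
    have hm := ncard_edgeSet_eq_deleteIncidenceSet G u
    have hc := ncard_colors_eq_deleteIncidenceSet G col u
    have hch : (N + 1 + 2).choose 2 = (N + 2) + (N + 2).choose 2 := by
      rw [Nat.choose_succ_succ' (N + 2) 1, Nat.choose_one_right]
    refine ⟨by omega, fun heq => ?_⟩
    have hcomplete := ih2 (by omega)
    have hrest : ∀ a ∈ S, ∀ b ∈ S, a ≠ u → b ≠ u → a ≠ b → G.Adj a b := fun a ha b hb hau hbu hab =>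
      hmono (hcomplete a (Finset.mem_erase.2 ⟨hau, ha⟩) b (Finset.mem_erase.2 ⟨hbu, hb⟩) hab)
    have hsat : (saturatedColors G col u).ncard ≤ 1 := by
      rw [Set.ncard_le_one (s := saturatedColors G col u)
        ((Set.toFinite (col '' G.edgeSet)).subset Set.sdiff_subset)]
      intro κ hκ μ hμ
      obtain ⟨x, hx, rfl⟩ := exists_adj_of_mem_saturatedColors hκ
      obtain ⟨y, hy, rfl⟩ := exists_adj_of_mem_saturatedColors hμ
      by_contra hne
      exact not_adj_of_saturatedColors hfree hx hy hκ hμ hne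
        (hrest x (hS _ _ hx.symm) y (hS _ _ hy.symm) hx.ne' hy.ne' (fun h => hne (by rw [h])))
    have hnbr : G.neighborSet u = ((S.erase u : Finset V) : Set V) := by
      refine Set.eq_of_subset_of_ncard_le (fun x hx => ?_) ?_ (Set.toFinite _)
      · exact Finset.mem_coe.2 (Finset.mem_erase.2 ⟨(G.ne_of_adj hx).symm, hS _ _ (G.adj_symm hx)⟩)
      · rw [Set.ncard_coe_finset, Finset.card_erase_of_mem hu]
        omega
    have hadj : ∀ b ∈ S, b ≠ u → G.Adj u b := fun b hb hbu => by
      rw [← SimpleGraph.mem_neighborSet, hnbr]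
      exact Finset.mem_coe.2 (Finset.mem_erase.2 ⟨hbu, hb⟩)
    intro a ha b hb hab
    by_cases hau : a = u
    · subst hau
      exact hadj b hb hab.symm
    · by_cases hbu : b = u
      · subst hbu
        exact (hadj a ha hau).symm
      · exact hrest a ha b hb hau hbu hab

lemma IsRainbowTriangle.of_insert_eq {V : Type*} [DecidableEq V] {G : SimpleGraph V}
    {col : Sym2 V → ℕ} {x y z a b c : V} (h : IsRainbowTriangle G col x y z)
    (heq : ({a, b, c} : Finset V) = {x, y, z}) (hab : a ≠ b) (hbc : b ≠ c) (hac : a ≠ c) :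
    IsRainbowTriangle G col a b c := by
  have ha : a = x ∨ a = y ∨ a = z := by
    have : a ∈ ({x, y, z} : Finset V) := by rw [← heq]; simp
    simpa using this
  have hb : b = x ∨ b = y ∨ b = z := by
    have : b ∈ ({x, y, z} : Finset V) := by rw [← heq]; simp
    simpa using this
  have hc : c = x ∨ c = y ∨ c = z := by
    have : c ∈ ({x, y, z} : Finset V) := by rw [← heq]; simp
    simpa using this
  obtain ⟨h1, h2, h3, h4, h5, h6⟩ := h
  have e1 : s(y, x) = s(x, y) := Sym2.eq_swap
  have e2 : s(z, y) = s(y, z) := Sym2.eq_swap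
  have e3 : s(z, x) = s(x, z) := Sym2.eq_swap
  have s1 := h1.symm
  have s2 := h2.symm
  have s3 := h3.symm
  unfold IsRainbowTriangle
  rcases ha with rfl | rfl | rfl <;> rcases hb with rfl | rfl | rfl <;>
    rcases hc with rfl | rfl | rfl <;> grind

/-- Merging two of the colors of a rainbow triangle loses at most one color and at least one
rainbow triangle. -/
lemma exists_coloring_ncard_rainbowTriangles_lt {V : Type*} [Finite V] [DecidableEq V]
    {G : SimpleGraph V} {col : Sym2 V → ℕ} {a b c : V} (h : IsRainbowTriangle G col a b c) :
    ∃ col' : Sym2 V → ℕ, (col '' G.edgeSet).ncard ≤ (col' '' G.edgeSet).ncard + 1 ∧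
      (rainbowTriangles G col').ncard < (rainbowTriangles G col).ncard := by
  let φ : ℕ → ℕ := fun κ => if κ = col s(a, b) then col s(b, c) else κ
  refine ⟨φ ∘ col, ?_, ?_⟩
  · refine le_trans (Set.ncard_le_ncard (t := insert (col s(a, b)) ((φ ∘ col) '' G.edgeSet)) ?_
      (Set.toFinite _)) (Set.ncard_insert_le _ _)
    rintro _ ⟨e, he, rfl⟩
    by_cases hc : col e = col s(a, b)
    · exact Or.inl hc
    · exact Or.inr ⟨e, he, if_neg hc⟩
  · refine Set.ncard_lt_ncard ⟨?_, fun hsub => ?_⟩ (Set.toFinite _)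
    · rintro t ⟨x, y, z, rfl, h1, h2, h3, h4, h5, h6⟩
      exact ⟨x, y, z, rfl, h1, h2, h3, fun e => h4 (congrArg φ e), fun e => h5 (congrArg φ e),
        fun e => h6 (congrArg φ e)⟩
    · obtain ⟨x, y, z, heq, hr⟩ := hsub ⟨a, b, c, rfl, h⟩
      have hr' := hr.of_insert_eq heq h.1.ne h.2.1.ne h.2.2.1.ne
      refine hr'.2.2.2.1 ?_
      simp [φ]

lemma edges_add_colors_lt_add_rainbowTriangles {V : Type*} [Fintype V] [DecidableEq V] {N : ℕ}
    (hN : Fintype.card V = N + 1) (G : SimpleGraph V) (t : ℕ) : ∀ col : Sym2 V → ℕ,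
      (rainbowTriangles G col).ncard ≤ t →
      G.edgeSet.ncard + (col '' G.edgeSet).ncard < (N + 2).choose 2 + t ∧
      (G.edgeSet.ncard + (col '' G.edgeSet).ncard + 1 = (N + 2).choose 2 + t → G = ⊤) := by
  induction t with
  | zero =>
    intro col ht
    have hempty : rainbowTriangles G col = ∅ :=
      (Set.ncard_eq_zero (Set.toFinite _)).1 (Nat.le_zero.1 ht)
    obtain ⟨h1, h2⟩ := edges_add_colors_lt_of_rainbowTriangle_free col N Finset.univ G hN
      (fun a _ _ => Finset.mem_univ a)
      (fun a b c h => (Set.eq_empty_iff_forall_notMem.1 hempty) {a, b, c} ⟨a, b, c, rfl, h⟩)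
    refine ⟨h1, fun heq => ?_⟩
    ext a b
    exact ⟨fun h => h.ne, fun h => h2 heq a (Finset.mem_univ a) b (Finset.mem_univ b) h⟩
  | succ t ih =>
    intro col ht
    by_cases hex : ∃ a b c, IsRainbowTriangle G col a b c
    · obtain ⟨a, b, c, h⟩ := hex
      obtain ⟨col', h1, h2⟩ := exists_coloring_ncard_rainbowTriangles_lt h
      obtain ⟨i1, i2⟩ := ih col' (by omega)
      exact ⟨by omega, fun heq => i2 (by omega)⟩
    · have hempty : rainbowTriangles G col = ∅ := by
        rw [Set.eq_empty_iff_forall_notMem]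
        rintro _ ⟨a, b, c, -, h⟩
        exact hex ⟨a, b, c, h⟩
      obtain ⟨i1, -⟩ := ih col (by simp [hempty])
      exact ⟨by omega, fun heq => by omega⟩

/-- If `G` is an edge-colored graph on `n` vertices with
`m(G) + c(G) ≥ (n+1 choose 2) + k - 1` for a positive integer `k`, and `G`
contains exactly `k` rainbow triangles, then
`m(G) + c(G) = (n+1 choose 2) + k - 1` and `G` is complete. -/
theorem stmt_5 (n k : ℕ) (hk : 1 ≤ k) (G : SimpleGraph (Fin n))
    (col : Sym2 (Fin n) → ℕ)
    (h : (n + 1).choose 2 + k - 1 ≤ G.edgeSet.ncard + (col '' G.edgeSet).ncard)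
    (hexact : (rainbowTriangles G col).ncard = k) :
    G.edgeSet.ncard + (col '' G.edgeSet).ncard = (n + 1).choose 2 + k - 1 ∧
      G = ⊤ := by
  obtain ⟨_, a, -⟩ := Set.nonempty_of_ncard_ne_zero (s := rainbowTriangles G col) (by omega)
  obtain ⟨N, rfl⟩ := Nat.exists_eq_succ_of_ne_zero (Fin.pos a).ne'
  obtain ⟨h1, h2⟩ := edges_add_colors_lt_add_rainbowTriangles (N := N) (Fintype.card_fin _) G k col
    hexact.le
  simp only [Nat.succ_eq_add_one, add_assoc, Nat.reduceAdd] at h ⊢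
  exact ⟨by omega, h2 (by omega)⟩
end

section
/- If G is an edge-colored graph on n vertices with n ≥ k ≥ 4 such that m(G) + c(G) ≥ C(n,2) + t_{n,k−2} + 2, then G contains a rainbow complete subgraph K_k on k vertices. -/
/-- `s` spans a rainbow clique in the edge-colored graph `(G, col)`:
`s` is a clique and distinct edges inside `s` receive distinct colors. -/
def IsRainbowClique {V : Type*} (G : SimpleGraph V) (col : Sym2 V → ℕ)
    (s : Finset V) : Prop :=
  G.IsClique s ∧
    ∀ a ∈ s, ∀ b ∈ s, ∀ c ∈ s, ∀ d ∈ s, a ≠ b → c ≠ d →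
      s(a, b) ≠ s(c, d) → col s(a, b) ≠ col s(c, d)

/-- `t_{n,r}`: the number of edges of the Turán graph `T_{n,r}`. -/
noncomputable def turanEdges (n r : ℕ) : ℕ :=
  (SimpleGraph.turanGraph n r).edgeSet.ncard

/-- The edge set of the copy of the Turán graph `T_{n,r}` on `Fin n` obtained by
relabelling the vertices of `SimpleGraph.turanGraph n r` along the
permutation `σ`. -/
def turanCopyEdges (n r : ℕ) (σ : Fin n ≃ Fin n) : Set (Sym2 (Fin n)) :=
  {e | e.map σ ∈ (SimpleGraph.turanGraph n r).edgeSet}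

open Finset

lemma turanEdges_self {r : ℕ} : turanEdges r r = r.choose 2 := by
  have h : SimpleGraph.turanGraph r r = ⊤ := SimpleGraph.turanGraph_eq_top.2 (Or.inr le_rfl)
  rw [turanEdges, h, Set.ncard_eq_toFinset_card', ← SimpleGraph.edgeFinset,
    SimpleGraph.card_edgeFinset_top_eq_card_choose_two, Fintype.card_fin]

lemma two_mul_turanEdges {r p s : ℕ} (hr : 0 < r) (hs : s < r) :
    2 * turanEdges (r * p + s) r = (r * p ^ 2 + 2 * p * s) * (r - 1) + s * (s - 1) := by
  have hcard : turanEdges (r * p + s) r =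
      (SimpleGraph.turanGraph (r * p + s) r).edgeFinset.card := by
    rw [turanEdges, Set.ncard_eq_toFinset_card', SimpleGraph.edgeFinset]
  have hmod : (r * p + s) % r = s := by
    rw [Nat.mul_add_mod, Nat.mod_eq_of_lt hs]
  rw [hcard, SimpleGraph.card_edgeFinset_turanGraph, hmod]
  have hsq : (r * p + s) ^ 2 - s ^ 2 = r * (r * p ^ 2 + 2 * p * s) := by
    rw [Nat.sub_eq_iff_eq_add (by gcongr; omega)]
    ring
  have heven : 2 ∣ (r * p ^ 2 + 2 * p * s) * (r - 1) := by
    have h1 : 2 ∣ r * (r - 1) := (Nat.even_mul_pred_self r).two_dvd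
    have h2 : (r * p ^ 2 + 2 * p * s) * (r - 1) =
        r * (r - 1) * p ^ 2 + 2 * (p * s * (r - 1)) := by ring
    rw [h2]
    exact dvd_add (h1.mul_right _) (Dvd.intro _ rfl)
  rw [hsq, mul_add, mul_comm 2 r, mul_assoc, Nat.mul_div_mul_left _ _ hr,
    Nat.mul_div_cancel' heven, Nat.choose_two_right,
    Nat.mul_div_cancel' (Nat.even_mul_pred_self s).two_dvd]

lemma turanEdges_succ {n r : ℕ} (hr : 0 < r) :
    turanEdges (n + 1) r + n / r = turanEdges n r + n := by
  obtain ⟨t, rfl⟩ := Nat.exists_eq_succ_of_ne_zero hr.ne'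
  have hs := Nat.mod_lt n hr
  have hn := Nat.div_add_mod n (t + 1)
  simp only [Nat.succ_eq_add_one] at *
  generalize n / (t + 1) = p at *
  generalize n % (t + 1) = s at *
  have h1 := two_mul_turanEdges (p := p) hr hs
  have h2 : 2 * turanEdges ((t + 1) * p + s + 1) (t + 1) =
      ((t + 1) * p ^ 2 + 2 * p * (s + 1)) * t + (s + 1) * s := by
    rcases Nat.lt_or_ge (s + 1) (t + 1) with h | h
    · simpa [add_assoc] using two_mul_turanEdges (p := p) hr h
    · obtain rfl : s = t := by omega
      have := two_mul_turanEdges (p := p + 1) hr hr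
      rw [show (s + 1) * p + s + 1 = (s + 1) * (p + 1) + 0 by ring, this]
      simp only [Nat.add_sub_cancel]
      ring
  rw [hn] at h1 h2
  simp only [Nat.add_sub_cancel] at h1
  have h3 : s * (s - 1) + s = s * s := by
    cases s with
    | zero => rfl
    | succ s => simp; ring
  nlinarith

lemma turanEdges_add_one {r : ℕ} (hr : 2 ≤ r) :
    turanEdges (r + 1) r + 1 = (r + 1).choose 2 := by
  have h := turanEdges_succ (n := r) (r := r) (by omega)
  rw [Nat.div_self (by omega), turanEdges_self] at h
  rw [h, Nat.choose_succ_succ' r 1, Nat.choose_one_right, add_comm]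
/-- If every out-neighborhood misses at most `p - #{non-neighbors}` vertices of `S`, then some
adjacent pair is dominated by a set of `r` vertices that are pairwise joined by arcs. -/
lemma exists_dominated_adj {V : Type*} [DecidableEq V] (G : SimpleGraph V) [DecidableRel G.Adj]
    (S : Finset V) (r p : ℕ) (hr : 2 ≤ r) (hS : r + 2 ≤ #S) (hp : r * p + 1 ≤ #S)
    (out : V → Finset V) (hout : ∀ v ∈ S, out v ⊆ {y ∈ S | G.Adj v y})
    (hw : ∀ v ∈ S, #(S \ out v) + #{y ∈ S | y ≠ v ∧ ¬G.Adj v y} ≤ p) :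
    ∃ K ⊆ S, #K = r ∧ (∀ x ∈ K, ∀ y ∈ K, x ≠ y → y ∈ out x ∨ x ∈ out y) ∧
      ∃ u ∈ S, ∃ w ∈ S, (∀ x ∈ K, u ∈ out x ∧ w ∈ out x) ∧ G.Adj u w := by
  by_contra hcon
  set μ : V → ℕ := fun v => #{y ∈ S | y ≠ v ∧ ¬G.Adj v y} with hμ
  have hself : ∀ v ∈ S, v ∉ out v := fun v hv h => by simpa using hout v hv h
  let chain : Finset V → Prop := fun K =>
    K ⊆ S ∧ ∀ x ∈ K, ∀ y ∈ K, x ≠ y → y ∈ out x ∨ x ∈ out y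
  let C : Finset V → Finset V := fun K => {y ∈ S | ∀ x ∈ K, y ∈ out x}
  have hcover : ∀ K, S ⊆ C K ∪ K.biUnion fun x => S \ out x := by
    intro K y hy
    by_cases h : ∀ x ∈ K, y ∈ out x
    · exact mem_union_left _ (mem_filter.2 ⟨hy, h⟩)
    · push Not at h
      obtain ⟨x, hx, hxy⟩ := h
      exact mem_union_right _ (mem_biUnion.2 ⟨x, hx, mem_sdiff.2 ⟨hy, hxy⟩⟩)
  have hcard : ∀ K ⊆ S, #S + ∑ x ∈ K, μ x ≤ #(C K) + #K * p := by
    intro K hK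
    have h1 := (card_le_card (hcover K)).trans (card_union_le _ _)
    have h2 : #(K.biUnion fun x => S \ out x) ≤ ∑ x ∈ K, #(S \ out x) := card_biUnion_le
    have h3 : ∑ x ∈ K, (#(S \ out x) + μ x) ≤ #K * p :=
      sum_le_card_nsmul _ _ _ fun x hx => hw x (hK hx)
    rw [sum_add_distrib] at h3
    omega
  have hnonempty : ∀ K ⊆ S, #K ≤ r → (C K).Nonempty := by
    intro K hK hKr
    have h1 := hcard K hK
    have h2 : #K * p ≤ r * p := Nat.mul_le_mul_right p hKr
    exact card_pos.1 (by omega)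
  have hinsert : ∀ K, chain K → ∀ u ∈ C K, u ∉ K ∧ chain (insert u K) := by
    intro K hK u hu
    obtain ⟨huS, hu⟩ := mem_filter.1 hu
    refine ⟨fun h => hself u huS (hu u h), insert_subset huS hK.1, ?_⟩
    intro x hx y hy hxy
    rcases mem_insert.1 hx with rfl | hx' <;> rcases mem_insert.1 hy with rfl | hy'
    · exact absurd rfl hxy
    · exact Or.inr (hu y hy')
    · exact Or.inl (hu x hx')
    · exact hK.2 x hx' y hy' hxy
  have hextend : ∀ d K, chain K → #K + d = r → ∃ K', K ⊆ K' ∧ chain K' ∧ #K' = r := by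
    intro d
    induction d with
    | zero => exact fun K hK hd => ⟨K, Subset.rfl, hK, hd⟩
    | succ d ih =>
      intro K hK hd
      obtain ⟨u, hu⟩ := hnonempty K hK.1 (by omega)
      obtain ⟨huK, hchain⟩ := hinsert K hK u hu
      obtain ⟨K', h1, h2⟩ := ih _ hchain (by rw [card_insert_of_notMem huK]; omega)
      exact ⟨K', (subset_insert _ _).trans h1, h2⟩
  have hext1 : ∀ v ∈ S, ∃ K', v ∈ K' ∧ chain K' ∧ #K' = r := by
    intro v hv
    obtain ⟨K', h1, h2⟩ := hextend (r - 1) {v}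
      ⟨singleton_subset_iff.2 hv, fun x hx y hy hxy =>
        absurd ((mem_singleton.1 hx).trans (mem_singleton.1 hy).symm) hxy⟩
      (by rw [card_singleton]; omega)
    exact ⟨K', singleton_subset_iff.1 h1, h2⟩
  have hext2 : ∀ v ∈ S, ∀ u ∈ out v, v ≠ u ∧ ∃ K', v ∈ K' ∧ u ∈ K' ∧ chain K' ∧ #K' = r := by
    intro v hv u hu
    have hne : v ≠ u := by rintro rfl; exact hself v hv hu
    have huS : u ∈ S := (mem_filter.1 (hout v hv hu)).1
    refine ⟨hne, ?_⟩
    obtain ⟨K', h1, h2⟩ := hextend (r - 2) {v, u}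
      ⟨insert_subset hv (singleton_subset_iff.2 huS), by
        intro x hx y hy hxy
        simp only [mem_insert, mem_singleton] at hx hy
        rcases hx with rfl | rfl <;> rcases hy with rfl | rfl <;> tauto⟩
      (by rw [card_pair hne]; omega)
    exact ⟨K', h1 (by simp), h1 (by simp), h2⟩
  have hindep : ∀ K, chain K → #K = r → ∀ u ∈ C K, #(C K) ≤ μ u + 1 := by
    intro K hK hKr u hu
    have hsub : (C K).erase u ⊆ {y ∈ S | y ≠ u ∧ ¬G.Adj u y} := by
      intro y hy
      obtain ⟨hyu, hy⟩ := mem_erase.1 hy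
      obtain ⟨hyS, hy⟩ := mem_filter.1 hy
      obtain ⟨huS, hu⟩ := mem_filter.1 hu
      exact mem_filter.2 ⟨hyS, hyu, fun hadj =>
        hcon ⟨K, hK.1, hKr, hK.2, u, huS, y, hyS, fun x hx => ⟨hu x hx, hy x hx⟩, hadj⟩⟩
    have := card_le_card hsub
    rw [card_erase_of_mem hu] at this
    simp only [hμ]
    omega
  have hmono : ∀ K, chain K → #K = r → ∀ u ∈ C K, #S + ∑ x ∈ K, μ x ≤ μ u + 1 + r * p := by
    intro K hK hKr u hu
    have h1 := hcard K hK.1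
    have h2 := hindep K hK hKr u hu
    rw [hKr] at h1
    omega
  obtain ⟨v, hv, hmax⟩ := S.exists_max_image μ (card_pos.1 (by omega))
  have hμ0 : ∀ x ∈ S, μ x = 0 := by
    obtain ⟨K, hvK, hK, hKr⟩ := hext1 v hv
    obtain ⟨u, hu⟩ := hnonempty K hK.1 hKr.le
    obtain ⟨huS, hu'⟩ := mem_filter.1 hu
    have h1 := hmono K hK hKr u hu
    have h2 : μ v ≤ ∑ x ∈ K, μ x := single_le_sum (fun _ _ => Nat.zero_le _) hvK
    obtain ⟨hne, K', hvK', huK', hK', hKr'⟩ := hext2 v hv u (hu' v hvK)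
    obtain ⟨u', hu2⟩ := hnonempty K' hK'.1 hKr'.le
    have h3 := hmono K' hK' hKr' u' hu2
    have h4 : μ v + μ u ≤ ∑ x ∈ K', μ x := by
      rw [← sum_pair hne]
      exact sum_le_sum_of_subset (insert_subset hvK' (singleton_subset_iff.2 huK'))
    have h5 := hmax u' (mem_filter.1 hu2).1
    intro x hx
    have := hmax x hx
    omega
  have hC1 : ∀ K, chain K → #K = r → #(C K) = 1 := by
    intro K hK hKr
    obtain ⟨u, hu⟩ := hnonempty K hK.1 hKr.le
    have h1 := hindep K hK hKr u hu
    have h2 := card_pos.2 ⟨u, hu⟩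
    rw [hμ0 u (mem_filter.1 hu).1] at h1
    omega
  have htight : ∀ K, chain K → #K = r → ∀ x ∈ K, ∀ Y : Finset V,
      S \ out x ⊆ Y ∪ (K.erase x).biUnion (fun z => S \ out z) → p ≤ #Y := by
    intro K hK hKr x hx Y hY
    have h1 : S ⊆ C K ∪ (Y ∪ (K.erase x).biUnion fun z => S \ out z) := by
      refine (hcover K).trans (union_subset_union_right ?_)
      rw [← insert_erase hx, biUnion_insert, insert_erase hx]
      exact union_subset hY subset_union_right
    have h2 := (card_le_card h1).trans (card_union_le _ _)
    have h3 := card_union_le Y ((K.erase x).biUnion fun z => S \ out z)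
    have h4 : #((K.erase x).biUnion fun z => S \ out z) ≤ #(K.erase x) * p :=
      card_biUnion_le_card_mul _ _ _ fun z hz =>
        (Nat.le_add_right _ _).trans (hw z (hK.1 (mem_of_mem_erase hz)))
    rw [card_erase_of_mem hx, hKr, Nat.sub_mul] at h4
    rw [hC1 K hK hKr] at h2
    have : 1 * p ≤ r * p := Nat.mul_le_mul_right p (by omega)
    omega
  obtain ⟨K, -, hK, hKr⟩ := hext1 v hv
  obtain ⟨u, hu⟩ := hnonempty K hK.1 hKr.le
  obtain ⟨huS, hu'⟩ := mem_filter.1 hu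
  have hn := hmono K hK hKr u hu
  rw [hμ0 u huS] at hn
  have hp2 : 2 ≤ p := by
    by_contra h
    have : r * p ≤ r * 1 := Nat.mul_le_mul_left r (by omega)
    omega
  have hXu : p ≤ #(S \ out u) := by
    obtain ⟨K', huK', hK', hKr'⟩ := hext1 u huS
    exact htight K' hK' hKr' u huK' _ subset_union_left
  obtain ⟨z, hz, hzu⟩ := exists_mem_ne (s := S \ out u) (by omega) u
  obtain ⟨hzS, hz'⟩ := mem_sdiff.1 hz
  have hzC : z ∉ C K := fun h =>
    hzu (card_le_one.1 (hC1 K hK hKr).le z h u hu)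
  obtain ⟨x, hx, hzx⟩ : ∃ x ∈ K, z ∉ out x := by
    by_contra! h
    exact hzC (mem_filter.2 ⟨hzS, h⟩)
  have hxS := hK.1 hx
  obtain ⟨hne, K', hxK', huK', hK', hKr'⟩ := hext2 x hxS u (hu' x hx)
  have h1 := htight K' hK' hKr' x hxK' ((S \ out x).erase z) (by
    intro y hy
    by_cases hyz : y = z
    · subst hyz
      exact mem_union_right _ (mem_biUnion.2 ⟨u, mem_erase.2 ⟨hne.symm, huK'⟩, hz⟩)
    · exact mem_union_left _ (mem_erase.2 ⟨hyz, hy⟩))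
  rw [card_erase_of_mem (mem_sdiff.2 ⟨hzS, hzx⟩)] at h1
  have := hw x hxS
  omega

/-- `A` consists of one neighbor of `v` for each color whose edges in `E` all contain `v`. -/
lemma exists_saturated_neighbors {V : Type*} [DecidableEq V] (E : Finset (Sym2 V))
    (col : Sym2 V → ℕ) (v : V) :
    ∃ A : Finset V, (∀ y ∈ A, s(v, y) ∈ E) ∧
      (∀ y ∈ A, ∀ e ∈ E, col e = col s(v, y) → v ∈ e) ∧
      (∀ y ∈ A, ∀ z ∈ A, col s(v, y) = col s(v, z) → y = z) ∧
      #(E.image col) ≤ #({e ∈ E | v ∉ e}.image col) + #A := by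
  set D := E.image col \ {e ∈ E | v ∉ e}.image col with hD
  have hsat : ∀ e ∈ E, col e ∈ D → v ∈ e := by
    intro e he h
    by_contra hv
    exact (mem_sdiff.1 h).2 (mem_image_of_mem col (mem_filter.2 ⟨he, hv⟩))
  have hsurj : Set.SurjOn (fun y => col s(v, y)) {y | s(v, y) ∈ E ∧ col s(v, y) ∈ D} D := by
    intro i hi
    obtain ⟨e, he, rfl⟩ := mem_image.1 (mem_sdiff.1 hi).1
    obtain ⟨y, rfl⟩ := Sym2.mem_iff_exists.1 (hsat e he hi)
    exact ⟨y, ⟨he, hi⟩, rfl⟩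
  obtain ⟨A, hA, hinj, himg⟩ := exists_subset_injOn_image_eq_of_surjOn _ _ hsurj
  refine ⟨A, fun y hy => (hA hy).1, fun y hy e he h => hsat e he (h ▸ (hA hy).2),
    fun y hy z hz h => hinj hy hz h, ?_⟩
  rw [← card_image_of_injOn hinj, himg, hD]
  have := le_card_sdiff ({e ∈ E | v ∉ e}.image col) (E.image col)
  omega

lemma isRainbowClique_insert_insert {V : Type*} [DecidableEq V] (G : SimpleGraph V)
    (col : Sym2 V → ℕ) (S : Finset V) (out : V → Finset V)
    (hadj : ∀ x ∈ S, ∀ y ∈ out x, y ∈ S ∧ G.Adj x y)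
    (hsat : ∀ x ∈ S, ∀ y ∈ out x, ∀ a ∈ S, ∀ b ∈ S, G.Adj a b →
      col s(a, b) = col s(x, y) → x ∈ s(a, b))
    (hinj : ∀ x ∈ S, ∀ y ∈ out x, ∀ z ∈ out x, col s(x, y) = col s(x, z) → y = z)
    (K : Finset V) (hKS : K ⊆ S) (hK : ∀ x ∈ K, ∀ y ∈ K, x ≠ y → y ∈ out x ∨ x ∈ out y)
    (u w : V) (hu : u ∈ S) (hw : w ∈ S) (hdom : ∀ x ∈ K, u ∈ out x ∧ w ∈ out x)
    (huw : G.Adj u w) :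
    IsRainbowClique G col (insert u (insert w K)) := by
  have huK : u ∉ K := fun h => (hadj u hu u (hdom u h).1).2.ne rfl
  have hwK : w ∉ K := fun h => (hadj w hw w (hdom w h).2).2.ne rfl
  have hsub : insert u (insert w K) ⊆ S := insert_subset hu (insert_subset hw hKS)
  have hpair : ∀ a ∈ insert u (insert w K), ∀ b ∈ insert u (insert w K), a ≠ b →
      (∃ x ∈ K, ∃ y ∈ out x, s(a, b) = s(x, y)) ∨ s(a, b) = s(u, w) := by
    have key : ∀ a ∈ K, ∀ b ∈ insert u (insert w K), a ≠ b →
        ∃ x ∈ K, ∃ y ∈ out x, s(a, b) = s(x, y) := by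
      intro a ha b hb hab
      rcases mem_insert.1 hb with rfl | hb
      · exact ⟨a, ha, b, (hdom a ha).1, rfl⟩
      rcases mem_insert.1 hb with rfl | hb
      · exact ⟨a, ha, b, (hdom a ha).2, rfl⟩
      rcases hK a ha b hb hab with h | h
      · exact ⟨a, ha, b, h, rfl⟩
      · exact ⟨b, hb, a, h, Sym2.eq_swap⟩
    intro a ha b hb hab
    by_cases haK : a ∈ K
    · exact Or.inl (key a haK b hb hab)
    by_cases hbK : b ∈ K
    · rw [Sym2.eq_swap]
      exact Or.inl (key b hbK a ha hab.symm)
    · right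
      simp only [mem_insert, haK, hbK, or_false] at ha hb
      rcases ha with rfl | rfl <;> rcases hb with rfl | rfl
      · exact absurd rfl hab
      · rfl
      · exact Sym2.eq_swap
      · exact absurd rfl hab
  have hclique : ∀ a ∈ insert u (insert w K), ∀ b ∈ insert u (insert w K), a ≠ b →
      G.Adj a b := by
    intro a ha b hb hab
    rw [← SimpleGraph.mem_edgeSet]
    rcases hpair a ha b hb hab with ⟨x, hx, y, hy, h⟩ | h
    · rw [h]
      exact (hadj x (hKS hx) y hy).2
    · rw [h]
      exact huw
  refine ⟨fun a ha b hb hab => hclique a ha b hb hab, ?_⟩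
  intro a ha b hb c hc d hd hab hcd hne hcol
  rcases hpair a ha b hb hab with ⟨x, hx, y, hy, h1⟩ | h1 <;>
    rcases hpair c hc d hd hcd with ⟨z, hz, t, ht, h2⟩ | h2
  · have hxs := hsat x (hKS hx) y hy c (hsub hc) d (hsub hd) (hclique c hc d hd hcd)
      (by rw [← hcol, h1])
    have hzs := hsat z (hKS hz) t ht a (hsub ha) b (hsub hb) (hclique a ha b hb hab)
      (by rw [hcol, h2])
    by_cases hxz : x = z
    · subst hxz
      rw [h1, h2] at hcol hne
      exact hne (by rw [hinj x (hKS hx) y hy t ht hcol])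
    · have hx1 : x ∈ s(a, b) := h1 ▸ Sym2.mem_mk_left x y
      have hz1 : z ∈ s(c, d) := h2 ▸ Sym2.mem_mk_left z t
      exact hne (((Sym2.mem_and_mem_iff hxz).1 ⟨hx1, hzs⟩).trans
        ((Sym2.mem_and_mem_iff hxz).1 ⟨hxs, hz1⟩).symm)
  · have := hsat x (hKS hx) y hy u hu w hw huw (by rw [← h2, ← hcol, h1])
    rcases Sym2.mem_iff.1 this with rfl | rfl <;> contradiction
  · have := hsat z (hKS hz) t ht u hu w hw huw (by rw [← h1, hcol, h2])
    rcases Sym2.mem_iff.1 this with rfl | rfl <;> contradiction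
  · exact hne (h1.trans h2.symm)

open Classical in
lemma exists_rainbowClique_subset {V : Type*} [Fintype V] (G : SimpleGraph V) (col : Sym2 V → ℕ)
    (r : ℕ) (hr : 2 ≤ r) (n : ℕ) (hn : r + 1 ≤ n) : ∀ (S : Finset V), #S = n →
    n.choose 2 + turanEdges n r + 2 ≤
      #{e ∈ G.edgeFinset | ∀ x ∈ e, x ∈ S} + #({e ∈ G.edgeFinset | ∀ x ∈ e, x ∈ S}.image col) →
    ∃ s : Finset V, #s = r + 2 ∧ IsRainbowClique G col s := by
  induction n, hn using Nat.le_induction with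
  | base =>
    intro S hS h
    have h1 : {e ∈ G.edgeFinset | ∀ x ∈ e, x ∈ S} ⊆ S.offDiag.image Sym2.mk.uncurry := by
      intro e he
      induction e with
      | _ a b =>
        simp only [mem_filter, SimpleGraph.mem_edgeFinset, SimpleGraph.mem_edgeSet,
          Sym2.mem_iff, forall_eq_or_imp, forall_eq] at he
        exact mem_image.2 ⟨(a, b), mem_offDiag.2 ⟨he.2.1, he.2.2, he.1.ne⟩, rfl⟩
    have h2 := card_le_card h1
    rw [Sym2.card_image_offDiag, hS] at h2
    have h3 := card_image_le (s := {e ∈ G.edgeFinset | ∀ x ∈ e, x ∈ S}) (f := col)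
    have h4 := turanEdges_add_one hr
    omega
  | succ n hn ih =>
    intro S hS h
    by_contra hcon
    set E := {e ∈ G.edgeFinset | ∀ x ∈ e, x ∈ S} with hE
    have hmem : ∀ a b, s(a, b) ∈ E ↔ G.Adj a b ∧ a ∈ S ∧ b ∈ S := by
      intro a b
      simp [hE]
    have herase : ∀ v, {e ∈ E | v ∉ e} = {e ∈ G.edgeFinset | ∀ x ∈ e, x ∈ S.erase v} := by
      intro v
      ext e
      simp only [hE, mem_filter, mem_erase, and_assoc]
      refine and_congr_right fun _ => ⟨fun h x hx => ⟨?_, h.1 x hx⟩, fun h =>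
        ⟨fun x hx => (h x hx).2, fun hv => (h v hv).1 rfl⟩⟩
      rintro rfl
      exact h.2 hx
    choose out hout hsat hinj hcolors using exists_saturated_neighbors E col
    obtain ⟨K, hKS, hKr, hK, u, hu, w, hw, hdom, huw⟩ :=
      exists_dominated_adj G S r (n / r) hr (by omega)
        (by have := Nat.mul_div_le n r; omega) out
        (fun v hv y hy => by
          have := (hmem v y).1 (hout v y hy)
          exact mem_filter.2 ⟨this.2.2, this.1⟩)
        (fun v hv => by
          have hsmall : #{e ∈ E | v ∉ e} + #({e ∈ E | v ∉ e}.image col) <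
              n.choose 2 + turanEdges n r + 2 := by
            by_contra! hge
            rw [herase v] at hge
            exact hcon (ih (S.erase v) (by rw [card_erase_of_mem hv, hS]; rfl) hge)
          have hedges : #E ≤ #{e ∈ E | v ∉ e} + #{y ∈ S | G.Adj v y} := by
            have hsub : E ⊆ {e ∈ E | v ∉ e} ∪ {y ∈ S | G.Adj v y}.image (fun y => s(v, y)) := by
              intro e he
              by_cases hve : v ∈ e
              · obtain ⟨y, rfl⟩ := Sym2.mem_iff_exists.1 hve
                have := (hmem v y).1 he
                exact mem_union_right _
                  (mem_image_of_mem _ (mem_filter.2 ⟨this.2.2, this.1⟩))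
              · exact mem_union_left _ (mem_filter.2 ⟨he, hve⟩)
            exact (card_le_card hsub).trans ((card_union_le _ _).trans
              (Nat.add_le_add_left card_image_le _))
          have hnon : #{y ∈ S | G.Adj v y} + #{y ∈ S | y ≠ v ∧ ¬G.Adj v y} = n := by
            rw [← card_union_of_disjoint, ← filter_or]
            · have : {y ∈ S | G.Adj v y ∨ y ≠ v ∧ ¬G.Adj v y} = S.erase v := by
                ext y
                simp only [mem_filter, mem_erase]
                by_cases hvy : G.Adj v y
                · simp [hvy, hvy.ne']
                · simp [hvy, and_comm]
              rw [this, card_erase_of_mem hv, hS]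
              rfl
            · exact disjoint_filter.2 fun y _ h h' => h'.2 h
          have hsd : #(S \ out v) + #(out v) = n + 1 := by
            rw [card_sdiff_add_card_eq_card, hS]
            exact fun y hy => ((hmem v y).1 (hout v y hy)).2.2
          have hc := hcolors v
          have ht := turanEdges_succ (n := n) (r := r) (by omega)
          have hch : (n + 1).choose 2 = n + n.choose 2 := by
            rw [Nat.choose_succ_succ' n 1, Nat.choose_one_right]
          omega)
    refine hcon ⟨insert u (insert w K), ?_, isRainbowClique_insert_insert G col S out
      (fun x _ y hy => ?_) (fun x _ y hy a ha b hb hab hcol =>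
        hsat x y hy _ ((hmem a b).2 ⟨hab, ha, hb⟩) hcol)
      (fun x _ => hinj x) K hKS hK u w hu hw hdom huw⟩
    · have hirr : ∀ x, x ∉ out x := fun x h => ((hmem x x).1 (hout x x h)).1.ne rfl
      rw [card_insert_of_notMem, card_insert_of_notMem, hKr]
      · exact fun h => hirr w (hdom w h).2
      · exact fun h => (mem_insert.1 h).elim huw.ne fun h => hirr u (hdom u h).1
    · have := (hmem x y).1 (hout x y hy)
      exact ⟨this.2.2, this.1⟩

/-- If `G` is an edge-colored graph on `n ≥ k ≥ 4` vertices with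
`m(G) + c(G) ≥ (n choose 2) + t_{n,k-2} + 2`, then `G` contains a rainbow `K_k`. -/
theorem stmt_7 (n k : ℕ) (hk : 4 ≤ k) (hkn : k ≤ n) (G : SimpleGraph (Fin n))
    (col : Sym2 (Fin n) → ℕ)
    (h : n.choose 2 + turanEdges n (k - 2) + 2 ≤
      G.edgeSet.ncard + (col '' G.edgeSet).ncard) :
    ∃ s : Finset (Fin n), s.card = k ∧ IsRainbowClique G col s := by
  classical
  obtain ⟨r, rfl⟩ := Nat.exists_eq_add_of_le' (show 2 ≤ k by omega)
  refine exists_rainbowClique_subset G col r (by omega) n (by omega) univ (by simp) ?_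
  simp only [mem_univ, implies_true, filter_true]
  rw [← Set.ncard_coe_finset, ← Set.ncard_coe_finset, coe_image, SimpleGraph.coe_edgeFinset]
  exact h
end

section
/- If G is an edge-colored graph on n vertices with n ≥ k ≥ 6 such that m(G) + c(G) = C(n,2) + t_{n,k−2} + 1 and G does not contain a rainbow K_k, then G belongs to the class ℋ_k. -/
/-- `(G, col)` is (isomorphic, up to renaming colors, to) the extremal coloring
`H_{n,r}`: `G` is the complete graph on `n` vertices, some spanning copy of the
Turán graph `T_{n,r}` is rainbow, and all the remaining edges share one single
further color not used on that copy. -/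
def IsHnr (n r : ℕ) (G : SimpleGraph (Fin n)) (col : Sym2 (Fin n) → ℕ) : Prop :=
  G = ⊤ ∧ ∃ σ : Fin n ≃ Fin n,
    Set.InjOn col (turanCopyEdges n r σ) ∧
    ∃ d, (∀ e : Sym2 (Fin n), ¬ e.IsDiag → e ∉ turanCopyEdges n r σ → col e = d) ∧
      d ∉ col '' turanCopyEdges n r σ

/-- `(G, col)` contains a spanning rainbow copy of the Turán graph `T_{n,r}`. -/
def HasSpanningRainbowTuran (n r : ℕ) (G : SimpleGraph (Fin n))
    (col : Sym2 (Fin n) → ℕ) : Prop :=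
  ∃ σ : Fin n ≃ Fin n, turanCopyEdges n r σ ⊆ G.edgeSet ∧
    Set.InjOn col (turanCopyEdges n r σ)

/-- The class `ℋ_k`: either `(G, col)` is a copy of `H_{n,k-2}`, or
`⌊n/(k-2)⌋ = 1`, `G` is complete, `c(G) = t_{n,k-2} + 1`, and `G` contains a
rainbow `T_{n,k-2}` but no rainbow `K_k`. -/
def HClass (n k : ℕ) (G : SimpleGraph (Fin n)) (col : Sym2 (Fin n) → ℕ) : Prop :=
  IsHnr n (k - 2) G col ∨
    (n / (k - 2) = 1 ∧ G = ⊤ ∧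
      (col '' G.edgeSet).ncard = turanEdges n (k - 2) + 1 ∧
      HasSpanningRainbowTuran n (k - 2) G col ∧
      ¬ ∃ s : Finset (Fin n), s.card = k ∧ IsRainbowClique G col s)

namespace RainbowTuran

open Finset
open scoped Classical

variable {V : Type*} (G : SimpleGraph V) (col : Sym2 V → ℕ)

/-- The edges of `G` with both endpoints in `S`. -/
noncomputable def edgesIn (S : Finset V) : Finset (Sym2 V) := {e ∈ S.sym2 | e ∈ G.edgeSet}

/-- The colors of the edges of `G` with both endpoints in `S`. -/
noncomputable def colorsIn (S : Finset V) : Finset ℕ := (edgesIn G S).image col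

/-- The neighbors of `v` in `S`. -/
noncomputable def nbrsIn (S : Finset V) (v : V) : Finset V := {u ∈ S | G.Adj v u}

variable {G col} {S T : Finset V} {u v w : V} {r : ℕ}

@[simp] lemma mk_mem_edgesIn : s(u, v) ∈ edgesIn G S ↔ (u ∈ S ∧ v ∈ S) ∧ G.Adj u v := by
  simp [edgesIn]

@[simp] lemma mem_nbrsIn : u ∈ nbrsIn G S v ↔ u ∈ S ∧ G.Adj v u := by simp [nbrsIn]

lemma mem_of_mem_edgesIn {e : Sym2 V} (he : e ∈ edgesIn G S) (hv : v ∈ e) : v ∈ S := by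
  obtain ⟨u, rfl⟩ := hv
  exact (mk_mem_edgesIn.1 he).1.1

lemma edgesIn_mono (h : S ⊆ T) : edgesIn G S ⊆ edgesIn G T := by
  intro e
  induction e with | _ a b =>
  simp only [mk_mem_edgesIn]
  exact fun ⟨⟨ha, hb⟩, hab⟩ => ⟨⟨h ha, h hb⟩, hab⟩

lemma mem_colorsIn (hu : u ∈ S) (hv : v ∈ S) (h : G.Adj u v) :
    col s(u, v) ∈ colorsIn G col S :=
  mem_image_of_mem _ (mk_mem_edgesIn.2 ⟨⟨hu, hv⟩, h⟩)

lemma colorsIn_mono (h : S ⊆ T) : colorsIn G col S ⊆ colorsIn G col T :=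
  image_subset_image (edgesIn_mono h)

lemma card_nbrsIn_lt (hv : v ∈ S) : #(nbrsIn G S v) < #S :=
  card_lt_card (ssubset_iff_of_subset (filter_subset _ _) |>.2 ⟨v, hv, by simp⟩)

variable (G col S) in
/-- Every rainbow clique in `W` extends to one with `j` more vertices in `S`. -/
def Extends (j : ℕ) (W : Finset V) : Prop :=
  W ⊆ S ∧ ∀ T ⊆ W, IsRainbowClique G col T →
    ∃ T' ⊆ S, #T' = #T + j ∧ IsRainbowClique G col T'

lemma extends_zero : Extends G col S 0 S :=
  ⟨Subset.rfl, fun T hT h => ⟨T, hT, rfl, h⟩⟩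

variable [DecidableEq V]

variable (G col) in
/-- The colors inside `S` that occur only at edges incident with `v`. -/
noncomputable def newColors (S : Finset V) (v : V) : Finset ℕ :=
  colorsIn G col S \ colorsIn G col (S.erase v)

lemma edgesIn_eq_union (hv : v ∈ S) :
    edgesIn G S = edgesIn G (S.erase v) ∪ (nbrsIn G S v).image (fun u => s(v, u)) := by
  ext e
  induction e with | _ a b =>
  simp only [mk_mem_edgesIn, mem_union, mem_image, mem_nbrsIn, mem_erase, Sym2.eq_iff]
  constructor
  · rintro ⟨⟨ha, hb⟩, hab⟩
    by_cases h1 : a = v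
    · subst h1; exact Or.inr ⟨b, ⟨hb, hab⟩, Or.inl ⟨rfl, rfl⟩⟩
    by_cases h2 : b = v
    · subst h2; exact Or.inr ⟨a, ⟨ha, hab.symm⟩, Or.inr ⟨rfl, rfl⟩⟩
    exact Or.inl ⟨⟨⟨h1, ha⟩, h2, hb⟩, hab⟩
  · rintro (⟨⟨⟨-, ha⟩, -, hb⟩, hab⟩ | ⟨c, ⟨hc, hvc⟩, ⟨rfl, rfl⟩ | ⟨rfl, rfl⟩⟩)
    exacts [⟨⟨ha, hb⟩, hab⟩, ⟨⟨hv, hc⟩, hvc⟩, ⟨⟨hc, hv⟩, hvc.symm⟩]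

lemma card_edgesIn (hv : v ∈ S) :
    #(edgesIn G S) = #(edgesIn G (S.erase v)) + #(nbrsIn G S v) := by
  rw [edgesIn_eq_union hv, card_union_of_disjoint, card_image_of_injective]
  · intro a b h
    exact Sym2.congr_right.1 h
  · rw [disjoint_left]
    intro e he he'
    obtain ⟨u, -, rfl⟩ := mem_image.1 he'
    simp at he

lemma card_colorsIn :
    #(colorsIn G col S) = #(colorsIn G col (S.erase v)) + #(newColors G col S v) := by
  rw [newColors, card_sdiff_of_subset (colorsIn_mono (erase_subset _ _))]
  have := card_le_card (colorsIn_mono (G := G) (col := col) (erase_subset v S))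
  omega

variable (G col) in
lemma exists_outIn (hv : v ∈ S) : ∃ N ⊆ nbrsIn G S v, Set.InjOn (fun u => col s(v, u)) N ∧
    N.image (fun u => col s(v, u)) = newColors G col S v := by
  obtain ⟨N, h1, h2, h3⟩ := Finset.exists_subset_injOn_image_eq_of_surjOn
    (f := fun u => col s(v, u)) (nbrsIn G S v : Set V) (newColors G col S v) (by
      intro c hc
      rw [mem_coe, newColors, mem_sdiff, colorsIn, mem_image, edgesIn_eq_union hv] at hc
      obtain ⟨⟨e, he, rfl⟩, hc⟩ := hc
      rcases mem_union.1 he with he | he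
      · exact absurd (mem_image_of_mem _ he) hc
      · obtain ⟨u, hu, rfl⟩ := mem_image.1 he
        exact ⟨u, hu, rfl⟩)
  exact ⟨N, by exact_mod_cast h1, h2, h3⟩

variable (G col S) in
/-- A set of neighbors of `v` in `S` joined to `v` by exactly one edge of each new color. -/
noncomputable def outIn (v : V) : Finset V :=
  if hv : v ∈ S then (exists_outIn G col hv).choose else ∅

lemma outIn_spec (hv : v ∈ S) : outIn G col S v ⊆ nbrsIn G S v ∧
    Set.InjOn (fun u => col s(v, u)) (outIn G col S v) ∧
    (outIn G col S v).image (fun u => col s(v, u)) = newColors G col S v := by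
  rw [outIn, dif_pos hv]
  exact (exists_outIn G col hv).choose_spec

lemma card_outIn (hv : v ∈ S) : #(outIn G col S v) = #(newColors G col S v) := by
  rw [← (outIn_spec hv).2.2, card_image_of_injOn (outIn_spec hv).2.1]

lemma outIn_subset (hv : v ∈ S) : outIn G col S v ⊆ S :=
  (outIn_spec hv).1.trans (filter_subset _ _)

lemma adj_of_mem_outIn (hv : v ∈ S) (hu : u ∈ outIn G col S v) : G.Adj v u :=
  (mem_nbrsIn.1 ((outIn_spec hv).1 hu)).2

lemma col_notMem_of_mem_outIn (hv : v ∈ S) (hu : u ∈ outIn G col S v) :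
    col s(v, u) ∉ colorsIn G col (S.erase v) := by
  have := mem_image_of_mem (fun u => col s(v, u)) hu
  rw [(outIn_spec hv).2.2, newColors, mem_sdiff] at this
  exact this.2

lemma notMem_outIn_self (hv : v ∈ S) : v ∉ outIn G col S v :=
  fun h => (adj_of_mem_outIn hv h).ne rfl

/-- A rainbow clique inside the set `outIn G col S v` can be extended by `v`. -/
lemma isRainbowClique_insert (hv : v ∈ S) (hT : T ⊆ outIn G col S v)
    (h : IsRainbowClique G col T) : IsRainbowClique G col (insert v T) := by
  have hvT : v ∉ T := fun h => notMem_outIn_self hv (hT h)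
  have hTS : T ⊆ S.erase v := fun x hx => mem_erase.2
    ⟨fun h => hvT (h ▸ hx), outIn_subset hv (hT hx)⟩
  refine ⟨?_, ?_⟩
  · rw [coe_insert, SimpleGraph.isClique_insert]
    exact ⟨h.1, fun b hb _ => adj_of_mem_outIn hv (hT hb)⟩
  have key : ∀ b ∈ T, ∀ c ∈ T, ∀ d ∈ T, c ≠ d → col s(v, b) ≠ col s(c, d) := by
    intro b hb c hc d hd hcd he
    apply col_notMem_of_mem_outIn hv (hT hb)
    rw [he]
    exact mem_colorsIn (hTS hc) (hTS hd) (h.1 hc hd hcd)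
  have inj : ∀ b ∈ T, ∀ c ∈ T, s(v, b) ≠ s(v, c) → col s(v, b) ≠ col s(v, c) := by
    intro b hb c hc hne he
    exact hne (by rw [(outIn_spec hv).2.1 (hT hb) (hT hc) he])
  intro a ha b hb c hc d hd hab hcd hne
  rw [mem_insert] at ha hb hc hd
  rcases ha with rfl | ha <;> rcases hb with rfl | hb
  · exact absurd rfl hab
  · rcases hc with rfl | hc <;> rcases hd with rfl | hd
    · exact absurd rfl hcd
    · exact inj _ hb _ hd hne
    · rw [Sym2.eq_swap (a := c)] at hne ⊢
      exact inj _ hb _ hc hne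
    · exact key _ hb _ hc _ hd hcd
  · rw [Sym2.eq_swap (a := a)] at hne ⊢
    rcases hc with rfl | hc <;> rcases hd with rfl | hd
    · exact absurd rfl hcd
    · exact inj _ ha _ hd hne
    · rw [Sym2.eq_swap (a := c)] at hne ⊢
      exact inj _ ha _ hc hne
    · exact key _ ha _ hc _ hd hcd
  · rcases hc with rfl | hc <;> rcases hd with rfl | hd
    · exact absurd rfl hcd
    · exact (key _ hd _ ha _ hb hab).symm
    · rw [Sym2.eq_swap (a := c)] at hne ⊢
      exact (key _ hc _ ha _ hb hab).symm
    · exact h.2 _ ha _ hb _ hc _ hd hab hcd hne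

lemma isRainbowClique_pair (h : G.Adj u v) : IsRainbowClique G col {u, v} := by
  refine ⟨by simp [SimpleGraph.isClique_insert, h], ?_⟩
  intro a ha b hb c hc d hd hab hcd hne
  simp only [mem_insert, mem_singleton] at ha hb hc hd
  rcases ha with rfl | rfl <;> rcases hb with rfl | rfl <;> rcases hc with rfl | rfl <;>
    rcases hd with rfl | rfl <;> simp_all [Sym2.eq_swap]

section TuranNumber

/-- The graph on `ℕ` whose restrictions to initial segments are the Turán graphs. -/
def modGraph (r : ℕ) : SimpleGraph ℕ where
  Adj v w := v % r ≠ w % r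
  symm.symm _ _ h := h.symm
  loopless.irrefl _ h := h rfl

lemma turanEdges_eq_card (n r : ℕ) : turanEdges n r = #(edgesIn (modGraph r) (range n)) := by
  rw [turanEdges, ← Set.ncard_image_of_injective _ (Sym2.map.injective Fin.val_injective),
    ← Set.ncard_coe_finset]
  congr 1
  ext e
  induction e with | _ a b =>
  rw [mem_coe, mk_mem_edgesIn, mem_range, mem_range]
  constructor
  · rintro ⟨e, he, h⟩
    induction e with | _ x y =>
    rw [Sym2.map_mk, Sym2.eq_iff] at h
    rw [SimpleGraph.mem_edgeSet, SimpleGraph.turanGraph_adj] at he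
    rcases h with ⟨rfl, rfl⟩ | ⟨rfl, rfl⟩
    exacts [⟨⟨x.2, y.2⟩, he⟩, ⟨⟨y.2, x.2⟩, he.symm⟩]
  · rintro ⟨⟨ha, hb⟩, h⟩
    exact ⟨s(⟨a, ha⟩, ⟨b, hb⟩), h, rfl⟩

lemma turanEdges_succ (hr : 0 < r) (n : ℕ) :
    turanEdges (n + 1) r = turanEdges n r + (n - n / r) := by
  rw [turanEdges_eq_card, turanEdges_eq_card, card_edgesIn (self_mem_range_succ n),
    range_add_one, erase_insert notMem_range_self]
  congr 1
  have h := Nat.count_modEq_card (r := r) n hr n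
  rw [if_neg (lt_irrefl _), Nat.count_eq_card_filter_range] at h
  have h2 := card_filter_add_card_filter_not (s := range n) (fun x => x ≡ n [MOD r])
  rw [h, card_range] at h2
  have h3 : nbrsIn (modGraph r) (insert n (range n)) n = {x ∈ range n | ¬ x ≡ n [MOD r]} := by
    ext x
    rw [mem_nbrsIn, mem_insert, mem_filter]
    constructor
    · rintro ⟨rfl | hx, h⟩
      · exact absurd rfl h
      · exact ⟨hx, fun h' => h h'.symm⟩
    · exact fun ⟨hx, h⟩ => ⟨Or.inr hx, fun h' => h h'.symm⟩
  rw [h3]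
  simp only [add_zero] at h2
  omega

lemma turanEdges_of_le (hr : 0 < r) {n : ℕ} (hn : n ≤ r) : turanEdges n r = n.choose 2 := by
  induction n with
  | zero => simp [turanEdges_eq_card, edgesIn]
  | succ n ih =>
    rw [turanEdges_succ hr, ih (by omega), Nat.div_eq_of_lt (by omega), Nat.choose_succ_succ' n 1]
    simp; omega

lemma turanEdges_add_of_le {n : ℕ} (h1 : r ≤ n) (h2 : n ≤ 2 * r) (hr : 0 < r) :
    turanEdges n r + (n - r) = n.choose 2 := by
  induction n, h1 using Nat.le_induction with
  | base => simp [turanEdges_of_le hr]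
  | succ n hn ih =>
    have : n / r = 1 := Nat.div_eq_of_lt_le (by omega) (by omega)
    have := ih (by omega)
    rw [turanEdges_succ hr, Nat.choose_succ_succ' n 1]
    simp; omega

end TuranNumber

lemma card_inter_outIn {W : Finset V} (hW : W ⊆ S) (hv : v ∈ S) :
    #W + #(outIn G col S v) ≤ #(W ∩ outIn G col S v) + #S := by
  have h1 := card_union_add_card_inter W (outIn G col S v)
  have h2 := card_le_card (union_subset hW (outIn_subset (G := G) (col := col) hv))
  omega

lemma exists_greedy {s : ℕ} (C : ℕ → Finset V → Prop) (hsub : ∀ j W, C j W → W ⊆ S)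
    (hstep : ∀ j W, ∀ v ∈ W, C j W → C (j + 1) (W ∩ outIn G col S v))
    (hs : ∀ v ∈ S, #S ≤ #(outIn G col S v) + s) (m : ℕ) :
    ∀ j W, C j W → m * s < #W → ∃ W', C (j + m) W' ∧ W' ⊆ W ∧ #W ≤ #W' + m * s := by
  induction m with
  | zero => exact fun j W hW _ => ⟨W, hW, Subset.rfl, by simp⟩
  | succ m ih =>
    intro j W hW hlt
    obtain ⟨v, hv⟩ := card_pos.1 (by omega : 0 < #W)
    have hle := card_inter_outIn (hsub j W hW) (hsub j W hW hv) (G := G) (col := col)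
    have := hs v (hsub j W hW hv)
    rw [add_mul, one_mul] at hlt ⊢
    obtain ⟨W', h1, h2, h3⟩ := ih (j + 1) _ (hstep j W v hv hW) (by omega)
    exact ⟨W', by rwa [add_assoc, add_comm 1 m] at h1, h2.trans inter_subset_left, by omega⟩

lemma Extends.step {j : ℕ} {W : Finset V} (h : Extends G col S j W) (hv : v ∈ W) :
    Extends G col S (j + 1) (W ∩ outIn G col S v) := by
  refine ⟨inter_subset_left.trans h.1, fun T hT hr => ?_⟩
  have hv' := h.1 hv
  have hT2 := hT.trans inter_subset_right
  obtain ⟨T', h1, h2, h3⟩ := h.2 (insert v T)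
    (insert_subset hv (hT.trans inter_subset_left)) (isRainbowClique_insert hv' hT2 hr)
  rw [card_insert_of_notMem fun h => notMem_outIn_self hv' (hT2 h)] at h2
  exact ⟨T', h1, by omega, h3⟩

theorem exists_isRainbowClique {s : ℕ} (hr : 2 ≤ r) (hrs : r * s < #S) (hrS : r + 2 ≤ #S)
    (hdeg : ∀ v ∈ S, 2 * #S ≤ #(nbrsIn G S v) + #(outIn G col S v) + s + 1) :
    ∃ T ⊆ S, #T = r + 2 ∧ IsRainbowClique G col T := by
  by_contra hno
  have hnb : ∀ v ∈ S, #(nbrsIn G S v) < #S := fun v hv => card_nbrsIn_lt hv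
  have hout : ∀ v ∈ S, #S ≤ #(outIn G col S v) + s := fun v hv => by
    have := hdeg v hv; have := hnb v hv; omega
  obtain ⟨r, rfl⟩ : ∃ t, r = t + 2 := ⟨r - 2, by omega⟩
  have hmul : (r + 2) * s = r * s + s + s := by ring
  -- common out-neighborhoods of `r + 2` vertices are independent
  have indep : ∀ W, Extends G col S (r + 2) W → ∀ w ∈ W, #W + #(nbrsIn G S w) ≤ #S := by
    intro W hW w hw
    rw [← card_union_of_disjoint]
    · exact card_le_card (union_subset hW.1 (filter_subset _ _))
    rw [disjoint_left]
    intro u hu hu'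
    rw [mem_nbrsIn] at hu'
    obtain ⟨T, h1, h2, h3⟩ := hW.2 {w, u} (by simp [insert_subset_iff, hw, hu])
      (isRainbowClique_pair hu'.2)
    rw [card_pair hu'.2.ne] at h2
    exact hno ⟨T, h1, by omega, h3⟩
  have greedy := exists_greedy (G := G) (col := col) (s := s) (S := S)
    (fun j W => Extends G col S j W) (fun _ _ h => h.1) (fun _ _ _ hv h => h.step hv) hout
  have stepcard : ∀ W ⊆ S, ∀ v ∈ S, #W + #(outIn G col S v) ≤ #(W ∩ outIn G col S v) + #S :=
    fun W hW v hv => card_inter_outIn hW hv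
  obtain ⟨v₁, hv₁, hmin⟩ := exists_min_image S (fun v => #(nbrsIn G S v))
    (card_pos.1 (by omega))
  -- `G` is complete on `S`
  have hcomp : ∀ v ∈ S, #(nbrsIn G S v) + 1 = #S := by
    have e1 := (extends_zero (G := G) (col := col) (S := S)).step hv₁
    have c1 := stepcard S Subset.rfl v₁ hv₁
    have d1 := hdeg v₁ hv₁
    have n1 := hnb v₁ hv₁
    obtain ⟨W, hW, hWsub, hWc⟩ := greedy (r + 1) _ _ e1 (by rw [add_mul, one_mul]; omega)
    rw [add_mul, one_mul] at hWc
    obtain ⟨v₂, hv₂⟩ := card_pos.1 (by omega : 0 < #W)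
    have i2 := indep W (by convert hW using 1; omega) v₂ hv₂
    have hv₂S := hW.1 hv₂
    have m2 := hmin v₂ hv₂S
    have e2 := e1.step (hWsub hv₂)
    have c2 := stepcard _ e1.1 v₂ hv₂S
    have d2 := hdeg v₂ hv₂S
    have n2 := hnb v₂ hv₂S
    obtain ⟨W', hW', -, hWc'⟩ := greedy r _ _ e2 (by omega)
    obtain ⟨v₃, hv₃⟩ := card_pos.1 (by omega : 0 < #W')
    have i3 := indep W' (by convert hW' using 1; omega) v₃ hv₃
    have m3 := hmin v₃ (hW'.1 hv₃)
    intro v hv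
    have := hmin v hv
    have := hnb v hv
    omega
  have small : ∀ W, Extends G col S (r + 2) W → #W ≤ 1 := by
    intro W hW
    rcases W.eq_empty_or_nonempty with rfl | ⟨w, hw⟩
    · simp
    · have := indep W hW w hw; have := hcomp w (hW.1 hw); omega
  obtain ⟨W₀, hW₀, -, hWc₀⟩ := greedy (r + 2) 0 S extends_zero hrs
  have hS : #S = (r + 2) * s + 1 := by
    have := small W₀ (by convert hW₀ using 1; omega); omega
  have hout' : ∀ v ∈ S, #(outIn G col S v) + s = #S := by
    intro v hv
    refine le_antisymm ?_ (hout v hv)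
    by_contra hlt
    have e1 := (extends_zero (G := G) (col := col) (S := S)).step hv
    have c1 := stepcard S Subset.rfl v hv
    obtain ⟨W, hW, -, hWc⟩ := greedy (r + 1) _ _ e1 (by rw [add_mul, one_mul]; omega)
    rw [add_mul, one_mul] at hWc
    have := small W (by convert hW using 1; omega)
    omega
  have hdisj : ∀ v ∈ S, ∀ u ∈ outIn G col S v,
      Disjoint (S \ outIn G col S v) (S \ outIn G col S u) := by
    intro v hv u hu
    have huS := outIn_subset hv hu
    have e1 := (extends_zero (G := G) (col := col) (S := S)).step hv
    have e2 := e1.step (mem_inter.2 ⟨huS, hu⟩)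
    have hle : #(S ∩ outIn G col S v ∩ outIn G col S u) ≤ r * s + 1 := by
      by_contra hlt
      obtain ⟨W, hW, -, hWc⟩ := greedy r _ _ e2 (by omega)
      have := small W (by convert hW using 1; omega)
      omega
    rw [disjoint_iff_inter_eq_empty, ← card_eq_zero]
    have h1 := card_union_add_card_inter (S \ outIn G col S v) (S \ outIn G col S u)
    rw [← sdiff_inter_distrib_right, card_sdiff_of_subset (inter_subset_left.trans (outIn_subset hv)),
      card_sdiff_of_subset (outIn_subset hv), card_sdiff_of_subset (outIn_subset huS)] at h1
    rw [inter_eq_right.2 (outIn_subset hv)] at hle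
    have := hout' v hv
    have := hout' u huS
    omega
  have hne : ∀ v ∈ S, v ∈ S \ outIn G col S v := fun v hv =>
    mem_sdiff.2 ⟨hv, notMem_outIn_self hv⟩
  obtain ⟨W, ⟨hW, hcl⟩, -, hWc⟩ := exists_greedy (G := G) (col := col) (s := s) (S := S)
    (fun j W => Extends G col S j W ∧ ∀ w ∈ W, S \ outIn G col S w ⊆ W) (fun _ _ h => h.1.1)
    (fun j W v hv h => ⟨h.1.step hv, fun w hw x hx => by
      rw [mem_inter] at hw ⊢
      refine ⟨h.2 w hw.1 hx, ?_⟩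
      by_contra hx'
      exact disjoint_left.1 (hdisj v (h.1.1 hv) w hw.2)
        (mem_sdiff.2 ⟨(mem_sdiff.1 hx).1, hx'⟩) hx⟩) hout (r + 2) 0 S
    ⟨extends_zero, fun w _ => sdiff_subset⟩ hrs
  have hW1 := small W (by convert hW using 1; omega)
  obtain ⟨w, hw⟩ := card_pos.1 (by omega : 0 < #W)
  have hc := card_le_card (hcl w hw)
  have h1 := hout' w (hW.1 hw)
  rw [card_sdiff_of_subset (outIn_subset (hW.1 hw))] at hc
  have : s ≤ 1 := by omega
  interval_cases s <;> omega

variable (G col) in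
/-- The number of edges plus the number of colors inside `S`. -/
noncomputable def weight (S : Finset V) : ℕ := #(edgesIn G S) + #(colorsIn G col S)

lemma weight_eq (hv : v ∈ S) : weight G col S =
    weight G col (S.erase v) + (#(nbrsIn G S v) + #(outIn G col S v)) := by
  rw [weight, weight, card_edgesIn hv, card_colorsIn (v := v), card_outIn hv]
  omega

lemma edgesIn_subset : edgesIn G S ⊆ S.offDiag.image (Sym2.mk.uncurry) := by
  intro e
  induction e with | _ a b =>
  rw [mk_mem_edgesIn]
  rintro ⟨⟨ha, hb⟩, hab⟩
  exact mem_image.2 ⟨(a, b), mem_offDiag.2 ⟨ha, hb, hab.ne⟩, rfl⟩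

lemma card_edgesIn_le : #(edgesIn G S) ≤ (#S).choose 2 :=
  (card_le_card edgesIn_subset).trans_eq (Sym2.card_image_offDiag S)

lemma card_edgesIn_of_isClique (h : G.IsClique S) : #(edgesIn G S) = (#S).choose 2 := by
  refine le_antisymm card_edgesIn_le ?_
  rw [← Sym2.card_image_offDiag S]
  refine card_le_card ?_
  rw [image_subset_iff]
  rintro ⟨a, b⟩ hab
  rw [mem_offDiag] at hab
  exact mk_mem_edgesIn.2 ⟨⟨hab.1, hab.2.1⟩, h hab.1 hab.2.1 hab.2.2⟩

lemma isClique_of_card_nbrsIn (h : ∀ v ∈ S, #S ≤ #(nbrsIn G S v) + 1) : G.IsClique S := by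
  intro a ha b hb hab
  rw [mem_coe] at ha hb
  have hsub : nbrsIn G S a ⊆ S.erase a := fun x hx =>
    mem_erase.2 ⟨(mem_nbrsIn.1 hx).2.ne', (mem_nbrsIn.1 hx).1⟩
  have := h a ha
  exact (mem_nbrsIn.1 ((eq_of_subset_of_card_le hsub
    (by rw [card_erase_of_mem ha]; omega)) ▸ mem_erase.2 ⟨hab.symm, hb⟩)).2

lemma exists_low_degree (hr : 2 ≤ r) (hrS : r + 2 ≤ #S)
    (hno : ¬ ∃ T ⊆ S, #T = r + 2 ∧ IsRainbowClique G col T) :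
    ∃ v ∈ S, #(nbrsIn G S v) + #(outIn G col S v) + (#S - 1) / r ≤ 2 * (#S - 1) := by
  by_contra! h
  refine hno (exists_isRainbowClique (s := (#S - 1) / r) hr ?_ hrS fun v hv => ?_)
  · have := Nat.mul_div_le (#S - 1) r
    omega
  · have := h v hv
    omega

lemma bound_succ (hr : 0 < r) (n : ℕ) : (n + 1).choose 2 + turanEdges (n + 1) r + n / r =
    n.choose 2 + turanEdges n r + 2 * n := by
  rw [turanEdges_succ hr, Nat.choose_succ_succ' n 1, Nat.choose_one_right,
    one_add_one_eq_two]
  have := Nat.div_le_self n r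
  omega

theorem weight_le (hr : 2 ≤ r) (hS : r + 1 ≤ #S)
    (hno : ¬ ∃ T ⊆ S, #T = r + 2 ∧ IsRainbowClique G col T) :
    weight G col S ≤ (#S).choose 2 + turanEdges #S r + 1 := by
  obtain ⟨n, hn⟩ : ∃ n, #S = n := ⟨_, rfl⟩
  induction n generalizing S with
  | zero => omega
  | succ n ih =>
    by_cases hlt : #S = r + 1
    · have h1 : #(edgesIn G S) ≤ (#S).choose 2 := card_edgesIn_le
      have h2 : #(colorsIn G col S) ≤ #(edgesIn G S) := card_image_le
      have h3 := turanEdges_add_of_le (r := r) (n := #S) (by omega) (by omega) (by omega)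
      rw [weight]
      omega
    · obtain ⟨v, hv, hd⟩ := exists_low_degree hr (by omega) hno
      have hc := card_erase_of_mem hv
      rw [hn, Nat.add_sub_cancel] at hc
      have h1 := ih (S := S.erase v) (by omega)
        (fun ⟨T, hT, h⟩ => hno ⟨T, hT.trans (erase_subset _ _), h⟩) hc
      rw [hc] at h1
      rw [weight_eq hv, hn]
      rw [hn, Nat.add_sub_cancel] at hd
      have := bound_succ (r := r) (by omega) n
      omega

lemma le_degree_of_weight_eq (hr : 2 ≤ r) (hrS : r + 2 ≤ #S)
    (hno : ¬ ∃ T ⊆ S, #T = r + 2 ∧ IsRainbowClique G col T)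
    (hw : weight G col S = (#S).choose 2 + turanEdges #S r + 1) (hv : v ∈ S) :
    2 * (#S - 1) ≤ #(nbrsIn G S v) + #(outIn G col S v) + (#S - 1) / r := by
  obtain ⟨n, hn⟩ : ∃ n, #S = n + 1 := ⟨#S - 1, by omega⟩
  have hc := card_erase_of_mem hv
  have h1 := weight_le (S := S.erase v) hr (by omega)
    (fun ⟨T, hT, h⟩ => hno ⟨T, hT.trans (erase_subset _ _), h⟩)
  rw [weight_eq hv] at hw
  rw [hn, Nat.add_sub_cancel] at hc ⊢
  rw [hc] at h1
  rw [hn] at hw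
  have := bound_succ (r := r) (by omega) n
  omega

section Matching

/-- If all but one of the edges at each vertex carry distinct colors that are new at this vertex,
then of two edges of the same color meeting `v` at least once, one is exceptional at `v`. -/
lemma exists_exceptional (hout : ∀ v ∈ S, #S ≤ #(outIn G col S v) + 2) :
    ∃ x : V → Sym2 V, (∀ v, v ∈ x v) ∧ ∀ v ∈ S, ∀ e ∈ edgesIn G S, ∀ e' ∈ edgesIn G S, v ∈ e →
      e ≠ e' → col e = col e' → e = x v ∨ e' = x v := by
  have hy : ∀ v, ∃ y, v ∈ S → ∀ u ∈ S, u ≠ v → u ∉ outIn G col S v → u = y := by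
    intro v
    by_cases hv : v ∈ S
    · have h1 : #((S.erase v) \ outIn G col S v) ≤ 1 := by
        rw [card_sdiff_of_subset, card_erase_of_mem hv]
        · have := hout v hv; omega
        · exact fun x hx => mem_erase.2
            ⟨fun h => notMem_outIn_self hv (h ▸ hx), outIn_subset hv hx⟩
      have : Nonempty V := ⟨v⟩
      obtain ⟨y, hy⟩ := card_le_one_iff_subset_singleton.1 h1
      exact ⟨y, fun _ u hu huv hu' => mem_singleton.1
        (hy (mem_sdiff.2 ⟨mem_erase.2 ⟨huv, hu⟩, hu'⟩))⟩
    · exact ⟨v, fun h => absurd h hv⟩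
  choose y hy using hy
  refine ⟨fun v => s(v, y v), fun v => Sym2.mem_mk_left _ _, ?_⟩
  intro v hv e he e' he' hve hne hcol
  obtain ⟨u, rfl⟩ := hve
  rw [mk_mem_edgesIn] at he
  by_cases hu : u ∈ outIn G col S v
  · right
    have hve' : v ∈ e' := by
      by_contra hve'
      apply col_notMem_of_mem_outIn hv hu
      rw [hcol]
      refine mem_image_of_mem _ ?_
      induction e' with | _ a b =>
      rw [Sym2.mem_iff, not_or] at hve'
      simp only [mk_mem_edgesIn, mem_erase] at he' ⊢
      exact ⟨⟨⟨Ne.symm hve'.1, he'.1.1⟩, Ne.symm hve'.2, he'.1.2⟩, he'.2⟩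
    obtain ⟨u', rfl⟩ := hve'
    rw [mk_mem_edgesIn] at he'
    rw [hy v hv u' he'.1.2 he'.2.ne' fun hu' => hne (by
      rw [(outIn_spec hv).2.1 hu hu' hcol])]
  · left
    rw [hy v hv u he.1.2 he.2.ne' hu]

/-- The edges outside a system of representatives of the colors are pairwise disjoint. -/
lemma eq_of_mem_of_mem {x : V → Sym2 V} {R : Finset (Sym2 V)}
    (hx : ∀ v ∈ S, ∀ e ∈ edgesIn G S, ∀ e' ∈ edgesIn G S, v ∈ e →
      e ≠ e' → col e = col e' → e = x v ∨ e' = x v)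
    (hR : R ⊆ edgesIn G S) (hcol : ∀ e ∈ edgesIn G S, ∃ e' ∈ R, col e' = col e)
    {b b' : Sym2 V} (hb : b ∈ edgesIn G S \ R) (hb' : b' ∈ edgesIn G S \ R)
    (hv : v ∈ b) (hv' : v ∈ b') : b = b' := by
  by_contra hne
  rw [mem_sdiff] at hb hb'
  have hvS := mem_of_mem_edgesIn hb.1 hv
  obtain ⟨e, he, hec⟩ := hcol b hb.1
  obtain ⟨e', he', hec'⟩ := hcol b' hb'.1
  have h1 := hx v hvS b hb.1 e (hR he) hv (fun h => hb.2 (h ▸ he)) hec.symm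
  have h2 := hx v hvS b' hb'.1 e' (hR he') hv' (fun h => hb'.2 (h ▸ he')) hec'.symm
  have h3 := hx v hvS b hb.1 b' hb'.1 hv hne
  grind

lemma card_biUnion_toFinset {B : Finset (Sym2 V)} (hB : B ⊆ edgesIn G S)
    (hd : ∀ b ∈ B, ∀ b' ∈ B, ∀ v ∈ b, v ∈ b' → b = b') :
    #(B.biUnion Sym2.toFinset) = 2 * #B := by
  rw [card_biUnion, sum_congr rfl (g := fun _ => 2), sum_const, smul_eq_mul, mul_comm]
  · intro b hb
    refine Sym2.card_toFinset_of_not_isDiag b ?_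
    have := hB hb
    induction b with | _ a c =>
    exact (mk_mem_edgesIn.1 this).2.ne
  · intro b hb b' hb' hne
    rw [Function.onFun, disjoint_left]
    intro v hv hv'
    rw [Sym2.mem_toFinset] at hv hv'
    exact hne (hd b hb b' hb' v hv hv')

/-- If a color repeats outside a system of representatives `R` missing at least three edges, and
the missed edges cover all vertices but `x` and `y`, then all missed edges have the color of
`s(x, y)`. -/
lemma col_eq_of_cover {f : V → Sym2 V} {R : Finset (Sym2 V)} {x y : V}
    (hf : ∀ v ∈ S, ∀ e ∈ edgesIn G S, ∀ e' ∈ edgesIn G S, v ∈ e →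
      e ≠ e' → col e = col e' → e = f v ∨ e' = f v)
    (hmem : ∀ v, v ∈ f v)
    (hR : R ⊆ edgesIn G S) (hcol : ∀ e ∈ edgesIn G S, ∃ e' ∈ R, col e' = col e)
    (hxy : S \ (edgesIn G S \ R).biUnion Sym2.toFinset = {x, y})
    (hcard : 3 ≤ #(edgesIn G S \ R)) :
    ∀ b ∈ edgesIn G S \ R, col b = col s(x, y) := by
  set B := edgesIn G S \ R with hBdef
  have hBE : ∀ b ∈ B, b ∈ edgesIn G S := fun b hb => (mem_sdiff.1 hb).1
  have hBR : ∀ b ∈ B, b ∉ R := fun b hb => (mem_sdiff.1 hb).2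
  have hcov : ∀ z ∈ S, z ≠ x → z ≠ y → ∃ b ∈ B, z ∈ b := by
    intro z hz h1 h2
    by_contra! h
    have : z ∈ ({x, y} : Finset V) := by
      rw [← hxy]
      simpa [hz] using h
    simp [h1, h2] at this
  have huncov : ∀ z, z = x ∨ z = y → z ∈ S ∧ ∀ b ∈ B, z ∉ b := by
    intro z hz
    have : z ∈ ({x, y} : Finset V) := by simpa using hz
    rw [← hxy] at this
    simpa using this
  choose! p hpR hpcol using hcol
  have hpne : ∀ b ∈ B, b ≠ p b := fun b hb h => hBR b hb (h ▸ hpR b (hBE b hb))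
  -- exchanging `b` and its representative keeps the missed edges disjoint
  have hdisj : ∀ b ∈ B, ∀ b' ∈ B, b' ≠ b → ∀ z ∈ p b, z ∉ b' := by
    intro b hb b' hb' hne z hz hz'
    have hpb := hpR b (hBE b hb)
    refine hBR b' hb' ?_
    rw [← eq_of_mem_of_mem (R := insert b (R.erase (p b))) (b := p b) (b' := b') hf ?_ ?_ ?_ ?_
      hz hz']
    · exact hpb
    · exact insert_subset (hBE b hb) ((erase_subset _ _).trans hR)
    · intro e he
      by_cases h : p e = p b
      · exact ⟨b, mem_insert_self _ _, by rw [← hpcol b (hBE b hb), ← h, hpcol e he]⟩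
      · exact ⟨p e, mem_insert_of_mem (mem_erase.2 ⟨h, hpR e he⟩), hpcol e he⟩
    · simp [hR hpb, (hpne b hb).symm]
    · simp [hBE b' hb', hne, hBR b' hb']
  have hp : ∀ b ∈ B, p b = f x ∨ p b = f y := by
    intro b hb
    have hpE := hR (hpR b (hBE b hb))
    by_contra! h
    have key : ∀ z ∈ p b, z ∈ b := by
      intro z hz
      by_cases hzxy : z = x ∨ z = y
      · exfalso
        obtain ⟨hzS, hzB⟩ := huncov z hzxy
        have := hf z hzS (p b) hpE b (hBE b hb) hz (hpne b hb).symm (hpcol b (hBE b hb))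
        rcases this with h' | h'
        · rcases hzxy with rfl | rfl
          exacts [h.1 h', h.2 h']
        · exact hzB b hb (h' ▸ hmem z)
      · rw [not_or] at hzxy
        obtain ⟨b', hb', hzb'⟩ := hcov z (mem_of_mem_edgesIn hpE hz) hzxy.1 hzxy.2
        by_contra hzb
        exact hdisj b hb b' hb' (fun h => hzb (h ▸ hzb')) z hz hzb'
    apply hpne b hb
    generalize p b = e at *
    induction e with | _ a c =>
    have hac := (mk_mem_edgesIn.1 hpE).2.ne
    exact (Sym2.mem_and_mem_iff hac).1 ⟨key a (Sym2.mem_mk_left _ _), key c (Sym2.mem_mk_right _ _)⟩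
  obtain ⟨b₁, hb₁, b₂, hb₂, hne, heq⟩ := exists_ne_map_eq_of_card_lt_of_maps_to
    (s := B) (t := {f x, f y}) (f := p) (lt_of_le_of_lt card_le_two (by omega))
    (fun b hb => by simpa using hp b hb)
  have hxyR : p b₁ = s(x, y) := by
    have hpE := hR (hpR b₁ (hBE b₁ hb₁))
    have key : ∀ z ∈ p b₁, z = x ∨ z = y := by
      intro z hz
      by_contra! h
      obtain ⟨b', hb', hzb'⟩ := hcov z (mem_of_mem_edgesIn hpE hz) h.1 h.2
      by_cases h1 : b' = b₁
      · exact hdisj b₂ hb₂ b' hb' (h1 ▸ hne) z (heq ▸ hz) hzb'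
      · exact hdisj b₁ hb₁ b' hb' h1 z hz hzb'
    generalize p b₁ = e at *
    induction e with | _ a c =>
    have hac := (mk_mem_edgesIn.1 hpE).2.ne
    have h1 := key a (Sym2.mem_mk_left _ _)
    have h2 := key c (Sym2.mem_mk_right _ _)
    rw [Sym2.eq_iff]
    grind
  have hexc : ∀ z, z = x ∨ z = y → f z = s(x, y) := by
    intro z hz
    obtain ⟨hzS, hzB⟩ := huncov z hz
    have := hf z hzS (p b₁) (hR (hpR b₁ (hBE b₁ hb₁))) b₁ (hBE b₁ hb₁)
      (by rw [hxyR]; simpa using hz) (hpne b₁ hb₁).symm (hpcol b₁ (hBE b₁ hb₁))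
    rcases this with h | h
    · rw [← h, hxyR]
    · exact absurd (h ▸ hmem z) (hzB b₁ hb₁)
  intro b hb
  rw [← hpcol b (hBE b hb)]
  rcases hp b hb with h | h
  · rw [h, hexc x (Or.inl rfl)]
  · rw [h, hexc y (Or.inr rfl)]

theorem exists_matching (hr : 4 ≤ r) (hrS : r + 2 ≤ #S) (hSr : #S ≤ 2 * r)
    (hno : ¬ ∃ T ⊆ S, #T = r + 2 ∧ IsRainbowClique G col T)
    (hw : weight G col S = (#S).choose 2 + turanEdges #S r + 1) :
    G.IsClique S ∧ ∃ M ⊆ edgesIn G S, (∀ b ∈ M, ∀ b' ∈ M, ∀ v ∈ b, v ∈ b' → b = b') ∧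
      #M + r = #S ∧ Set.InjOn col (edgesIn G S \ M : Finset (Sym2 V)) ∧
      (#S = 2 * r → ∃ d, (∀ e ∈ M, col e = d) ∧ ∀ e ∈ edgesIn G S \ M, col e ≠ d) := by
  have hdiv : (#S - 1) / r = 1 := Nat.div_eq_of_lt_le (by omega) (by omega)
  have hdeg : ∀ v ∈ S, 2 * (#S - 1) ≤ #(nbrsIn G S v) + #(outIn G col S v) + 1 := fun v hv => by
    have := le_degree_of_weight_eq (by omega) hrS hno hw hv
    rwa [hdiv] at this
  have hle : ∀ v ∈ S, #(outIn G col S v) ≤ #(nbrsIn G S v) :=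
    fun v hv => card_le_card (outIn_spec hv).1
  have hnb : ∀ v ∈ S, #(nbrsIn G S v) < #S := fun v hv => card_nbrsIn_lt hv
  have hcl : G.IsClique S := isClique_of_card_nbrsIn fun v hv => by
    have := hdeg v hv; have := hle v hv; omega
  refine ⟨hcl, ?_⟩
  obtain ⟨f, hmem, hf⟩ := exists_exceptional (G := G) (col := col) (S := S) fun v hv => by
    have := hdeg v hv; have := hnb v hv; omega
  obtain ⟨R, hR, hinj, himg⟩ := exists_subset_injOn_image_eq_of_surjOn
    (f := col) (edgesIn G S : Set (Sym2 V)) (colorsIn G col S) (by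
      intro c hc
      obtain ⟨e, he, rfl⟩ := mem_image.1 hc
      exact ⟨e, he, rfl⟩)
  rw [coe_subset] at hR
  have hcol : ∀ e ∈ edgesIn G S, ∃ e' ∈ R, col e' = col e := fun e he => by
    rw [← mem_image, himg]
    exact mem_image_of_mem _ he
  have hRcard : #R = #(colorsIn G col S) := by rw [← himg, card_image_of_injOn hinj]
  have hE := card_edgesIn_of_isClique hcl
  have ht := turanEdges_add_of_le (r := r) (n := #S) (by omega) hSr (by omega)
  have hBcard := card_sdiff_of_subset hR
  have hRle := card_le_card hR
  rw [weight] at hw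
  have hd : ∀ b ∈ edgesIn G S \ R, ∀ b' ∈ edgesIn G S \ R, ∀ v ∈ b, v ∈ b' → b = b' :=
    fun b hb b' hb' v hv hv' => eq_of_mem_of_mem hf hR hcol hb hb' hv hv'
  have hcov := card_biUnion_toFinset sdiff_subset hd
  have hcovS : (edgesIn G S \ R).biUnion Sym2.toFinset ⊆ S := by
    intro v hv
    simp only [mem_biUnion, Sym2.mem_toFinset] at hv
    obtain ⟨e, he, hv⟩ := hv
    exact mem_of_mem_edgesIn (mem_sdiff.1 he).1 hv
  have hleft := card_sdiff_of_subset hcovS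
  obtain ⟨x, hx, y, hy, hxy⟩ := one_lt_card.1
    (show 1 < #(S \ (edgesIn G S \ R).biUnion Sym2.toFinset) by omega)
  have hunc : ∀ z ∈ S \ (edgesIn G S \ R).biUnion Sym2.toFinset,
      z ∈ S ∧ ∀ b ∈ edgesIn G S \ R, z ∉ b := by
    intro z hz
    rw [mem_sdiff] at hz
    refine ⟨hz.1, fun b hb hzb => hz.2 (mem_biUnion.2 ⟨b, hb, Sym2.mem_toFinset.2 hzb⟩)⟩
  have hxyE : s(x, y) ∈ edgesIn G S :=
    mk_mem_edgesIn.2 ⟨⟨(hunc x hx).1, (hunc y hy).1⟩, hcl (hunc x hx).1 (hunc y hy).1 hxy⟩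
  have hxyB : s(x, y) ∉ edgesIn G S \ R := fun h => (hunc x hx).2 _ h (Sym2.mem_mk_left _ _)
  have hxyR : s(x, y) ∈ R := by
    by_contra h
    exact hxyB (mem_sdiff.2 ⟨hxyE, h⟩)
  have hxyd : ∀ b ∈ edgesIn G S \ R, ∀ v ∈ b, v ∉ s(x, y) := by
    intro b hb v hv hv'
    rcases Sym2.mem_iff.1 hv' with rfl | rfl
    exacts [(hunc _ hx).2 b hb hv, (hunc _ hy).2 b hb hv]
  have hsub : ∀ e ∈ edgesIn G S \ insert s(x, y) (edgesIn G S \ R), e ∈ R ∧ e ≠ s(x, y) := by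
    intro e he
    simp only [mem_sdiff, mem_insert, not_or, not_and, not_not] at he
    exact ⟨he.2.2 he.1, he.2.1⟩
  refine ⟨insert s(x, y) (edgesIn G S \ R), insert_subset hxyE sdiff_subset, ?_, ?_, ?_, ?_⟩
  · intro b hb b' hb' v hv hv'
    rcases mem_insert.1 hb with rfl | hb <;> rcases mem_insert.1 hb' with rfl | hb'
    · rfl
    · exact absurd hv (hxyd _ hb' _ hv')
    · exact absurd hv' (hxyd _ hb _ hv)
    · exact hd b hb b' hb' v hv hv'
  · rw [card_insert_of_notMem hxyB]
    omega
  · exact fun e he e' he' h => hinj (hsub e he).1 (hsub e' he').1 h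
  · intro h2r
    refine ⟨col s(x, y), ?_, fun e he h => (hsub e he).2 (hinj (hsub e he).1 hxyR h)⟩
    have hxyeq : S \ (edgesIn G S \ R).biUnion Sym2.toFinset = {x, y} := by
      refine (eq_of_subset_of_card_le (by simp [insert_subset_iff, hx, hy, -mem_sdiff]) ?_).symm
      rw [card_pair hxy]
      omega
    have := col_eq_of_cover hf hmem hR hcol hxyeq (by omega)
    intro e he
    rcases mem_insert.1 he with rfl | he
    · rfl
    · exact this e he

end Matching

section Extremal

/-- On `S`, the colored graph looks like the extremal coloring with the parts given by `part` and
with color `d` inside the parts. -/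
structure IsExtremalOn {V : Type*} (G : SimpleGraph V) (col : Sym2 V → ℕ) (S : Finset V)
    (part : V → Fin r) (d : ℕ) : Prop where
  isClique : G.IsClique S
  balanced : ∀ i j, #{v ∈ S | part v = i} ≤ #{v ∈ S | part v = j} + 1
  same : ∀ a ∈ S, ∀ b ∈ S, a ≠ b → part a = part b → col s(a, b) = d
  inj : ∀ a ∈ S, ∀ b ∈ S, ∀ a' ∈ S, ∀ b' ∈ S, part a ≠ part b → part a' ≠ part b' →
    col s(a, b) = col s(a', b') → s(a, b) = s(a', b')
  ne : ∀ a ∈ S, ∀ b ∈ S, part a ≠ part b → col s(a, b) ≠ d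

omit [DecidableEq V] in
lemma IsExtremalOn.div_le {part : V → Fin r} {d : ℕ} (h : IsExtremalOn G col S part d)
    (j : Fin r) : #S / r ≤ #{v ∈ S | part v = j} := by
  by_contra! hlt
  have hsum := card_eq_sum_card_fiberwise (f := part) (s := S) (t := univ) (fun _ _ => mem_univ _)
  have hlt' : ∑ i, #{v ∈ S | part v = i} < ∑ _i : Fin r, #S / r := by
    refine sum_lt_sum (fun i _ => ?_) ⟨j, mem_univ _, hlt⟩
    have := h.balanced i j
    omega
  rw [← hsum, sum_const, card_univ, Fintype.card_fin, smul_eq_mul] at hlt'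
  have := Nat.mul_div_le #S r
  omega

lemma exists_isExtremalOn_of_matching {M : Finset (Sym2 V)} {d : ℕ} (hr : 0 < r)
    (hcl : G.IsClique S) (hM : M ⊆ edgesIn G S)
    (hdisj : ∀ b ∈ M, ∀ b' ∈ M, ∀ v ∈ b, v ∈ b' → b = b') (hMr : #M = r) (hSr : #S = 2 * r)
    (hinj : Set.InjOn col (edgesIn G S \ M : Finset (Sym2 V)))
    (hd : ∀ e ∈ M, col e = d) (hd' : ∀ e ∈ edgesIn G S \ M, col e ≠ d) :
    ∃ part : V → Fin r, IsExtremalOn G col S part d := by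
  have hcov := card_biUnion_toFinset hM hdisj
  have hcovS : M.biUnion Sym2.toFinset = S := by
    refine eq_of_subset_of_card_le ?_ (by omega)
    intro v hv
    simp only [mem_biUnion, Sym2.mem_toFinset] at hv
    obtain ⟨e, he, hv⟩ := hv
    exact mem_of_mem_edgesIn (hM he) hv
  have hex : ∀ v, ∃ e, v ∈ S → e ∈ M ∧ v ∈ e := by
    intro v
    by_cases hv : v ∈ S
    · rw [← hcovS] at hv
      simp only [mem_biUnion, Sym2.mem_toFinset] at hv
      obtain ⟨e, he⟩ := hv
      exact ⟨e, fun _ => he⟩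
    · exact ⟨s(v, v), fun h => absurd h hv⟩
  choose g hgg using hex
  have hgM : ∀ v ∈ S, g v ∈ M := fun v hv => (hgg v hv).1
  have hg : ∀ v ∈ S, v ∈ g v := fun v hv => (hgg v hv).2
  let idx : Sym2 V → Fin r := fun e =>
    if he : e ∈ M then M.equivFinOfCardEq hMr ⟨e, he⟩ else ⟨0, hr⟩
  have hidx : ∀ a ∈ S, ∀ b ∈ S, idx (g a) = idx (g b) → g a = g b := by
    intro a ha b hb h
    simpa [idx, hgM a ha, hgM b hb] using h
  have hsame : ∀ a ∈ S, ∀ b ∈ S, a ≠ b → (idx (g a) = idx (g b) ↔ s(a, b) ∈ M) := by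
    intro a ha b hb hab
    constructor
    · intro h
      have h1 := hidx a ha b hb h
      have h2 := (Sym2.mem_and_mem_iff hab).1 ⟨hg a ha, h1 ▸ hg b hb⟩
      exact h2 ▸ hgM a ha
    · intro h
      rw [hdisj _ (hgM a ha) _ h a (hg a ha) (Sym2.mem_mk_left _ _),
        hdisj _ (hgM b hb) _ h b (hg b hb) (Sym2.mem_mk_right _ _)]
  have hcross : ∀ a ∈ S, ∀ b ∈ S, idx (g a) ≠ idx (g b) → s(a, b) ∈ edgesIn G S \ M := by
    intro a ha b hb h
    have hab : a ≠ b := fun hab => h (by rw [hab])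
    exact mem_sdiff.2 ⟨mk_mem_edgesIn.2 ⟨⟨ha, hb⟩, hcl ha hb hab⟩,
      fun hmem => h ((hsame a ha b hb hab).2 hmem)⟩
  have hfib : ∀ i, #{v ∈ S | idx (g v) = i} = 2 := by
    intro i
    obtain ⟨⟨e, he⟩, rfl⟩ := (M.equivFinOfCardEq hMr).surjective i
    have : {v ∈ S | idx (g v) = M.equivFinOfCardEq hMr ⟨e, he⟩} = e.toFinset := by
      ext v
      rw [mem_filter, Sym2.mem_toFinset]
      constructor
      · rintro ⟨hv, h⟩
        have : g v = e := by simpa [idx, hgM v hv] using h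
        exact this ▸ hg v hv
      · intro hv
        have hvS := mem_of_mem_edgesIn (hM he) hv
        refine ⟨hvS, ?_⟩
        have : g v = e := hdisj _ (hgM v hvS) _ he v (hg v hvS) hv
        simp [idx, this, he]
    rw [this]
    refine Sym2.card_toFinset_of_not_isDiag e ?_
    have := hM he
    induction e with | _ a c =>
    exact (mk_mem_edgesIn.1 this).2.ne
  refine ⟨fun v => idx (g v), hcl, fun i j => by rw [hfib, hfib]; omega, ?_, ?_, ?_⟩
  · intro a ha b hb hab h
    exact hd _ ((hsame a ha b hb hab).1 h)
  · intro a ha b hb a' ha' b' hb' h h' hc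
    exact hinj (hcross a ha b hb h) (hcross a' ha' b' hb' h') hc
  · intro a ha b hb h
    exact hd' _ (hcross a ha b hb h)

omit [DecidableEq V] in
lemma isRainbowClique_of_part {p : V → Fin r} (hcl : G.IsClique T)
    (hinj : ∀ a ∈ T, ∀ b ∈ T, ∀ a' ∈ T, ∀ b' ∈ T, p a ≠ p b → p a' ≠ p b' →
      col s(a, b) = col s(a', b') → s(a, b) = s(a', b'))
    (hne : ∀ a ∈ T, ∀ b ∈ T, ∀ a' ∈ T, ∀ b' ∈ T, a ≠ b → p a = p b → p a' ≠ p b' →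
      col s(a, b) ≠ col s(a', b'))
    (hsame : ∀ a ∈ T, ∀ b ∈ T, ∀ a' ∈ T, ∀ b' ∈ T, a ≠ b → a' ≠ b' → p a = p b → p a' = p b' →
      col s(a, b) = col s(a', b') → s(a, b) = s(a', b')) :
    IsRainbowClique G col T := by
  refine ⟨hcl, fun a ha b hb a' ha' b' hb' hab hab' hne' hc => ?_⟩
  by_cases h1 : p a = p b <;> by_cases h2 : p a' = p b'
  · exact hne' (hsame a ha b hb a' ha' b' hb' hab hab' h1 h2 hc)
  · exact hne a ha b hb a' ha' b' hb' hab h1 h2 hc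
  · exact hne a' ha' b' hb' a ha b hb hab' h2 h1 hc.symm
  · exact hne' (hinj a ha b hb a' ha' b' hb' h1 h2 hc)

/-- If `v` sends out-edges to all parts and the number of out-edges exceeds the number of parts,
then there is a rainbow clique with two more vertices than there are parts. -/
lemma IsExtremalOn.exists_isRainbowClique {part : V → Fin r} {d : ℕ} (hv : v ∈ S)
    (h : IsExtremalOn G col (S.erase v) part d)
    (hout : ∀ i, ∃ u ∈ outIn G col S v, part u = i) (hcard : r < #(outIn G col S v)) :
    ∃ T ⊆ S, #T = r + 2 ∧ IsRainbowClique G col T := by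
  choose u hu hpu using hout
  have huinj : Function.Injective u := fun i j hij => by rw [← hpu i, hij, hpu]
  have hcu : #(univ.image u) = r := by rw [card_image_of_injective _ huinj]; simp
  obtain ⟨u', hu', hu'n⟩ := exists_mem_notMem_of_card_lt_card (hcu.symm ▸ hcard)
  have hTN : insert u' (univ.image u) ⊆ outIn G col S v :=
    insert_subset hu' (image_subset_iff.2 fun i _ => hu i)
  have hTS : insert u' (univ.image u) ⊆ S.erase v := fun x hx => mem_erase.2
    ⟨fun hxv => notMem_outIn_self hv (hxv ▸ hTN hx), outIn_subset hv (hTN hx)⟩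
  have hpair : ∀ a ∈ insert u' (univ.image u), ∀ b ∈ insert u' (univ.image u), a ≠ b →
      part a = part b → s(a, b) = s(u', u (part u')) := by
    intro a ha b hb hab hp
    simp only [mem_insert, mem_image, mem_univ, true_and] at ha hb
    rcases ha with rfl | ⟨i, rfl⟩ <;> rcases hb with rfl | ⟨j, rfl⟩
    · exact absurd rfl hab
    · rw [hp, hpu]
    · rw [← hp, hpu, Sym2.eq_swap]
    · rw [hpu, hpu] at hp
      exact absurd (by rw [hp]) hab
  have hrb : IsRainbowClique G col (insert u' (univ.image u)) :=
    isRainbowClique_of_part (p := part) (h.isClique.subset hTS)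
      (fun a ha b hb a' ha' b' hb' => h.inj a (hTS ha) b (hTS hb) a' (hTS ha') b' (hTS hb'))
      (fun a ha b hb a' ha' b' hb' hab hp hp' => by
        rw [h.same a (hTS ha) b (hTS hb) hab hp]
        exact (h.ne a' (hTS ha') b' (hTS hb') hp').symm)
      (fun a ha b hb a' ha' b' hb' hab hab' hp hp' _ => by
        rw [hpair a ha b hb hab hp, hpair a' ha' b' hb' hab' hp'])
  refine ⟨_, insert_subset hv (hTS.trans (erase_subset _ _)), ?_,
    isRainbowClique_insert hv hTN hrb⟩
  rw [card_insert_of_notMem fun hmem => notMem_outIn_self hv (hTN hmem),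
    card_insert_of_notMem hu'n, hcu]

/-- Extending an extremal coloring by one vertex. -/
lemma IsExtremalOn.of_erase {part : V → Fin r} {d : ℕ} (hr : 3 ≤ r) (hv : v ∈ S)
    (h : IsExtremalOn G col (S.erase v) part d) (hSr : 2 * r ≤ #S - 1)
    (hno : ¬ ∃ T ⊆ S, #T = r + 2 ∧ IsRainbowClique G col T)
    (hdeg : 2 * (#S - 1) ≤ #(nbrsIn G S v) + #(outIn G col S v) + (#S - 1) / r) :
    ∃ part' : V → Fin r, IsExtremalOn G col S part' d := by
  have hcard := card_erase_of_mem hv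
  have hs2 : 2 ≤ (#S - 1) / r := (Nat.le_div_iff_mul_le (by omega)).2 hSr
  have hsr := Nat.mul_div_le (#S - 1) r
  have hdiv : ∀ i, (#S - 1) / r ≤ #{u ∈ S.erase v | part u = i} := hcard ▸ h.div_le
  generalize (#S - 1) / r = s at *
  have hnb := card_nbrsIn_lt (G := G) hv
  have hout_sub : outIn G col S v ⊆ S.erase v := fun x hx => mem_erase.2
    ⟨fun hxv => notMem_outIn_self hv (hxv ▸ hx), outIn_subset hv hx⟩
  have hout_le := card_le_card hout_sub
  have hmiss := card_sdiff_of_subset hout_sub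
  obtain ⟨i, hi⟩ : ∃ i, ∀ u ∈ outIn G col S v, part u ≠ i := by
    by_contra! hall
    refine hno (h.exists_isRainbowClique hv hall ?_)
    obtain ⟨t, rfl⟩ : ∃ t, s = t + 2 := ⟨s - 2, by omega⟩
    obtain ⟨q, rfl⟩ : ∃ q, r = q + 3 := ⟨r - 3, by omega⟩
    have : q + 3 + (t + 2) < (q + 3) * (t + 2) := by nlinarith
    omega
  have hisub : {u ∈ S.erase v | part u = i} ⊆ S.erase v \ outIn G col S v := fun u hu => by
    rw [mem_filter] at hu
    exact mem_sdiff.2 ⟨hu.1, fun hu' => hi u hu' hu.2⟩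
  have hicard := card_le_card hisub
  have hdivi := hdiv i
  have hieq : {u ∈ S.erase v | part u = i} = S.erase v \ outIn G col S v :=
    eq_of_subset_of_card_le hisub (by omega)
  have hout : ∀ u ∈ S.erase v, part u ≠ i → u ∈ outIn G col S v := by
    intro u hu hpu
    by_contra hu'
    have := mem_sdiff.2 ⟨hu, hu'⟩
    rw [← hieq, mem_filter] at this
    exact hpu this.2
  have hvadj : ∀ u ∈ S.erase v, G.Adj v u := by
    have hsub : nbrsIn G S v ⊆ S.erase v := fun x hx =>
      mem_erase.2 ⟨(mem_nbrsIn.1 hx).2.ne', (mem_nbrsIn.1 hx).1⟩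
    have heq := eq_of_subset_of_card_le hsub (by omega)
    intro u hu
    rw [← heq] at hu
    exact (mem_nbrsIn.1 hu).2
  have hcl : G.IsClique S := by
    rw [← insert_erase hv, coe_insert, SimpleGraph.isClique_insert]
    exact ⟨h.isClique, fun b hb _ => hvadj b hb⟩
  set part' := Function.update part v i with hpart'
  have hpv : part' v = i := Function.update_self ..
  have hpu : ∀ u ∈ S.erase v, part' u = part u := fun u hu =>
    Function.update_of_ne (mem_erase.1 hu).1 ..
  have hcase : ∀ u ∈ S, u = v ∨ u ∈ S.erase v := fun u hu => by
    by_cases huv : u = v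
    exacts [Or.inl huv, Or.inr (mem_erase.2 ⟨huv, hu⟩)]
  -- the edges between different parts
  have hcross : ∀ a ∈ S, ∀ b ∈ S, part' a ≠ part' b →
      (∃ u ∈ outIn G col S v, s(a, b) = s(v, u)) ∨
        (a ∈ S.erase v ∧ b ∈ S.erase v ∧ part a ≠ part b) := by
    intro a ha b hb hab
    rcases hcase a ha with rfl | ha' <;> rcases hcase b hb with rfl | hb'
    · exact absurd rfl hab
    · rw [hpv, hpu b hb'] at hab
      exact Or.inl ⟨b, hout b hb' hab.symm, rfl⟩
    · rw [hpv, hpu a ha'] at hab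
      exact Or.inl ⟨a, hout a ha' hab, Sym2.eq_swap⟩
    · rw [hpu a ha', hpu b hb'] at hab
      exact Or.inr ⟨ha', hb', hab⟩
  have hcolS : ∀ a ∈ S.erase v, ∀ b ∈ S.erase v, a ≠ b →
      col s(a, b) ∈ colorsIn G col (S.erase v) :=
    fun a ha b hb hab => mem_colorsIn ha hb (h.isClique ha hb hab)
  have hinj : ∀ a ∈ S, ∀ b ∈ S, ∀ a' ∈ S, ∀ b' ∈ S, part' a ≠ part' b → part' a' ≠ part' b' →
      col s(a, b) = col s(a', b') → s(a, b) = s(a', b') := by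
    intro a ha b hb a' ha' b' hb' hp hp' hc
    rcases hcross a ha b hb hp with ⟨u, hu, he⟩ | ⟨h1, h2, h3⟩ <;>
      rcases hcross a' ha' b' hb' hp' with ⟨u', hu', he'⟩ | ⟨h1', h2', h3'⟩
    · rw [he, he'] at hc ⊢
      rw [(outIn_spec hv).2.1 hu hu' hc]
    · rw [he] at hc
      exact absurd (hc ▸ hcolS a' h1' b' h2' (fun hab => h3' (by rw [hab])))
        (col_notMem_of_mem_outIn hv hu)
    · rw [he'] at hc
      exact absurd (hc ▸ hcolS a h1 b h2 (fun hab => h3 (by rw [hab])))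
        (col_notMem_of_mem_outIn hv hu')
    · exact h.inj a h1 b h2 a' h1' b' h2' h3 h3' hc
  have hdcol : d ∈ colorsIn G col (S.erase v) := by
    obtain ⟨a, ha, b, hb, hab⟩ := one_lt_card.1 (lt_of_lt_of_le (by omega) (hdiv i))
    rw [mem_filter] at ha hb
    rw [← h.same a ha.1 b hb.1 hab (ha.2.trans hb.2.symm)]
    exact hcolS a ha.1 b hb.1 hab
  have hne : ∀ a ∈ S, ∀ b ∈ S, part' a ≠ part' b → col s(a, b) ≠ d := by
    intro a ha b hb hp hc
    rcases hcross a ha b hb hp with ⟨u, hu, he⟩ | ⟨h1, h2, h3⟩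
    · rw [he] at hc
      exact col_notMem_of_mem_outIn hv hu (hc ▸ hdcol)
    · exact h.ne a h1 b h2 h3 hc
  -- the edges from `v` to its own part
  have hvsame : ∀ x ∈ S.erase v, part x = i → col s(v, x) = d := by
    intro x hx hxi
    by_contra hc
    have hbig : ∀ j b, ∃ u ∈ S.erase v, part u = j ∧ u ≠ b := by
      intro j b
      obtain ⟨u, hu, hub⟩ := exists_mem_ne (lt_of_lt_of_le (by omega) (hdiv j)) b
      rw [mem_filter] at hu
      exact ⟨u, hu.1, hu.2, hub⟩
    obtain ⟨b, hb, hbc⟩ : ∃ b, part' b ≠ i ∧ ∀ a ∈ S, ∀ a' ∈ S, part' a ≠ part' a' →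
        col s(a, a') = col s(v, x) → b = a ∨ b = a' := by
      by_cases hex : ∃ a ∈ S, ∃ a' ∈ S, part' a ≠ part' a' ∧ col s(a, a') = col s(v, x)
      · obtain ⟨a, ha, a', ha', hp, hc'⟩ := hex
        have : ∃ b, (b = a ∨ b = a') ∧ part' b ≠ i := by
          by_cases hai : part' a = i
          · exact ⟨a', Or.inr rfl, fun h => hp (hai.trans h.symm)⟩
          · exact ⟨a, Or.inl rfl, hai⟩
        obtain ⟨b, hb, hbi⟩ := this
        refine ⟨b, hbi, fun c hc c' hc'' hp' hcc => ?_⟩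
        have := hinj a ha a' ha' c hc c' hc'' hp hp' (hc'.trans hcc.symm)
        rw [← Sym2.mem_iff, ← this, Sym2.mem_iff]
        exact hb
      · obtain ⟨j, hj⟩ := Fintype.exists_ne_of_one_lt_card (α := Fin r) (by simp; omega) i
        obtain ⟨b, hb, hbj, -⟩ := hbig j v
        refine ⟨b, by rw [hpu b hb, hbj]; exact hj, fun a ha a' ha' hp hcc => ?_⟩
        exact absurd ⟨a, ha, a', ha', hp, hcc⟩ hex
    obtain ⟨j₀, hj₀⟩ : ∃ j₀ : Fin r, j₀ ∉ ({i, part' b} : Finset (Fin r)) := by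
      by_contra! hall
      have h1 := card_le_card (fun j _ => hall j : (univ : Finset (Fin r)) ⊆ {i, part' b})
      rw [card_univ, Fintype.card_fin] at h1
      have := card_le_two (a := i) (b := part' b)
      omega
    simp only [mem_insert, mem_singleton, not_or] at hj₀
    have hw : ∀ j, ∃ w ∈ S, part' w = j ∧ w ≠ b ∧ (j = i → w = v) := by
      intro j
      by_cases hj : j = i
      · exact ⟨v, hv, hpv.trans hj.symm, fun h => hb (h ▸ hpv), fun _ => rfl⟩
      · obtain ⟨u, hu, huj, hub⟩ := hbig j b
        exact ⟨u, (mem_erase.1 hu).2, (hpu u hu).trans huj, hub, fun h => absurd h hj⟩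
    choose w hwS hwp hwb hwi using hw
    have hwinj : Function.Injective w := fun j j' hjj => by rw [← hwp j, hjj, hwp]
    obtain ⟨u', hu', hu'j, hu'w⟩ := hbig j₀ (w j₀)
    have hpu' : part' u' = j₀ := (hpu u' hu').trans hu'j
    have hpx : part' x = i := (hpu x hx).trans hxi
    have hQS : insert x (insert u' (univ.image w)) ⊆ S :=
      insert_subset (mem_erase.1 hx).2 (insert_subset (mem_erase.1 hu').2
        (image_subset_iff.2 fun j _ => hwS j))
    have hQb : ∀ a ∈ insert x (insert u' (univ.image w)), a ≠ b := by
      intro a ha hab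
      simp only [mem_insert, mem_image, mem_univ, true_and] at ha
      rcases ha with rfl | rfl | ⟨j, rfl⟩
      · exact hb (hab ▸ hpx)
      · exact hj₀.2 (hab ▸ hpu'.symm)
      · exact hwb j hab
    have hpair : ∀ a ∈ insert x (insert u' (univ.image w)),
        ∀ a' ∈ insert x (insert u' (univ.image w)), a ≠ a' → part' a = part' a' →
        (s(a, a') = s(v, x) ∨ s(a, a') = s(w j₀, u')) := by
      intro a ha a' ha' hne hp
      have hwv : w i = v := hwi i rfl
      simp only [mem_insert, mem_image, mem_univ, true_and] at ha ha'
      rcases ha with hj | hj | ⟨j, hj⟩ <;> rcases ha' with hj' | hj' | ⟨j', hj'⟩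
      · exact absurd (hj.trans hj'.symm) hne
      · rw [hj, hj', hpx, hpu'] at hp
        exact absurd hp.symm hj₀.1
      · rw [hj, ← hj', hpx, hwp] at hp
        rw [hj, ← hj', ← hp, hwv]
        exact Or.inl Sym2.eq_swap
      · rw [hj, hj', hpx, hpu'] at hp
        exact absurd hp hj₀.1
      · exact absurd (hj.trans hj'.symm) hne
      · rw [hj, ← hj', hpu', hwp] at hp
        rw [hj, ← hj', ← hp]
        exact Or.inr Sym2.eq_swap
      · rw [← hj, hj', hpx, hwp] at hp
        rw [← hj, hj', hp, hwv]
        exact Or.inl rfl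
      · rw [← hj, hj', hpu', hwp] at hp
        rw [← hj, hj', hp]
        exact Or.inr rfl
      · rw [← hj, ← hj', hwp, hwp] at hp
        exact absurd (by rw [← hj, ← hj', hp]) hne
    have hcw : col s(w j₀, u') = d := by
      have hwj : w j₀ ∈ S.erase v := mem_erase.2
        ⟨fun h => hj₀.1 (by rw [← hwp j₀, h, hpv]), hwS j₀⟩
      refine h.same _ hwj _ hu' hu'w.symm ?_
      rw [hu'j, ← hpu _ hwj, hwp]
    refine hno ⟨_, hQS, ?_, isRainbowClique_of_part (p := part') (hcl.subset hQS)
      (fun a ha a' ha' c hc c' hc' =>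
        hinj a (hQS ha) a' (hQS ha') c (hQS hc) c' (hQS hc')) ?_ ?_⟩
    · rw [card_insert_of_notMem, card_insert_of_notMem, card_image_of_injective _ hwinj]
      · simp
      · simp only [mem_image, mem_univ, true_and, not_exists]
        intro j hj
        have : j = j₀ := by rw [← hwp j, hj, hpu']
        exact hu'w (this ▸ hj.symm)
      · simp only [mem_insert, mem_image, mem_univ, true_and, not_or, not_exists]
        refine ⟨fun h => hj₀.1 (by rw [← hpu', ← h, hpx]), fun j hj => ?_⟩
        have : j = i := by rw [← hwp j, hj, hpx]
        exact (mem_erase.1 hx).1 (by rw [← hj, hwi j this])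
    · intro a ha a' ha' c hc c' hc' hne' hp hp' heq
      rcases hpair a ha a' ha' hne' hp with h1 | h1
      · rw [h1] at heq
        rcases hbc c (hQS hc) c' (hQS hc') hp' heq.symm with h2 | h2
        exacts [hQb c hc h2.symm, hQb c' hc' h2.symm]
      · rw [h1, hcw] at heq
        exact hne c (hQS hc) c' (hQS hc') hp' heq.symm
    · intro a ha a' ha' c hc' c' hc'' hne1 hne2 hp hp' heq
      rcases hpair a ha a' ha' hne1 hp with h1 | h1 <;>
        rcases hpair c hc' c' hc'' hne2 hp' with h2 | h2
      · rw [h1, h2]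
      · rw [h1, h2, hcw] at heq
        exact absurd heq hc
      · rw [h1, h2, hcw] at heq
        exact absurd heq.symm hc
      · rw [h1, h2]
  have hfib : ∀ j, {u ∈ S | part' u = j} =
      if j = i then insert v {u ∈ S.erase v | part u = j} else {u ∈ S.erase v | part u = j} := by
    intro j
    ext u
    by_cases huv : u = v
    · subst huv
      split_ifs with hj <;> simp [hpv, hv, hj, eq_comm]
    · have : part' u = part u := Function.update_of_ne huv ..
      split_ifs with hj <;> simp [this, huv]
  refine ⟨part', hcl, fun j j' => ?_, ?_, hinj, hne⟩
  · have hb := h.balanced j j'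
    have hj' := hdiv j'
    rw [hfib, hfib]
    split_ifs with h1 h2 h2
    · rw [h1, h2]; omega
    · subst h1
      rw [card_insert_of_notMem (by simp)]
      omega
    · rw [card_insert_of_notMem (by simp)]
      omega
    · exact hb
  · intro a ha b hb hab hp
    rcases hcase a ha with rfl | ha' <;> rcases hcase b hb with rfl | hb'
    · exact absurd rfl hab
    · exact hvsame b hb' (by rw [← hpu b hb', ← hp, hpv])
    · rw [Sym2.eq_swap]
      exact hvsame a ha' (by rw [← hpu a ha', hp, hpv])
    · exact h.same a ha' b hb' hab (by rw [← hpu a ha', hp, hpu b hb'])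

theorem exists_isExtremalOn (hr : 4 ≤ r) (hSr : 2 * r ≤ #S)
    (hno : ¬ ∃ T ⊆ S, #T = r + 2 ∧ IsRainbowClique G col T)
    (hw : weight G col S = (#S).choose 2 + turanEdges #S r + 1) :
    ∃ (part : V → Fin r) (d : ℕ), IsExtremalOn G col S part d := by
  obtain ⟨n, hn⟩ : ∃ n, #S = n := ⟨_, rfl⟩
  induction n generalizing S with
  | zero => omega
  | succ n ih =>
    by_cases heq : #S = 2 * r
    · obtain ⟨hcl, M, hM, hdisj, hMr, hinj, hd⟩ :=
        exists_matching hr (by omega) (by omega) hno hw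
      obtain ⟨d, hd, hd'⟩ := hd heq
      obtain ⟨part, hp⟩ := exists_isExtremalOn_of_matching (by omega) hcl hM hdisj (by omega) heq
        hinj hd hd'
      exact ⟨part, d, hp⟩
    · obtain ⟨v, hv, hlow⟩ := exists_low_degree (by omega) (by omega) hno
      have hdeg := le_degree_of_weight_eq (by omega) (by omega) hno hw hv
      have hc := card_erase_of_mem hv
      rw [hn, Nat.add_sub_cancel] at hc
      have hno' : ¬ ∃ T ⊆ S.erase v, #T = r + 2 ∧ IsRainbowClique G col T :=
        fun ⟨T, hT, h⟩ => hno ⟨T, hT.trans (erase_subset _ _), h⟩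
      have hbound := bound_succ (r := r) (by omega) n
      obtain ⟨part, d, hp⟩ := ih (S := S.erase v) (by omega) hno' (by
        rw [weight_eq hv, hn] at hw
        rw [hn, Nat.add_sub_cancel] at hlow hdeg
        rw [hc]
        omega) hc
      obtain ⟨part', hp'⟩ := hp.of_erase (by omega) hv (by omega) hno hdeg
      exact ⟨part', d, hp'⟩

end Extremal

lemma exists_turanCopyEdges_eq {n : ℕ} (K : SimpleGraph (Fin n)) (hr : 0 < r)
    (hK : K.CliqueFree (r + 1)) (hc : K.edgeSet.ncard = turanEdges n r) :
    ∃ σ : Fin n ≃ Fin n, turanCopyEdges n r σ = K.edgeSet := by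
  have hmax : K.IsTuranMaximal r := by
    refine ⟨hK, fun H _ hH => ?_⟩
    have := (SimpleGraph.isTuranMaximal_turanGraph (n := n) hr).2 hH
    have h1 : #(SimpleGraph.turanGraph n r).edgeFinset = turanEdges n r := by
      rw [turanEdges, ← SimpleGraph.coe_edgeFinset, Set.ncard_coe_finset]
    have h2 : #K.edgeFinset = K.edgeSet.ncard := by
      rw [← SimpleGraph.coe_edgeFinset, Set.ncard_coe_finset]
    convert this.trans (h1.trans (hc.symm.trans h2.symm)).le
  obtain ⟨f⟩ := (SimpleGraph.isTuranMaximal_iff_nonempty_iso_turanGraph hr).1 hmax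
  have hcast : ∃ f : Fin n ≃ Fin n,
      ∀ a b, (SimpleGraph.turanGraph n r).Adj (f a) (f b) ↔ K.Adj a b := by
    have hn := Fintype.card_fin n
    generalize Fintype.card (Fin n) = m at f hn
    subst hn
    exact ⟨f.toEquiv, fun a b => f.map_rel_iff⟩
  obtain ⟨σ, hσ⟩ := hcast
  refine ⟨σ, ?_⟩
  ext e
  induction e with | _ a b =>
  simp [turanCopyEdges, hσ]

section Fin

variable {n : ℕ} {G : SimpleGraph (Fin n)} {col : Sym2 (Fin n) → ℕ}

lemma coe_edgesIn_univ : (edgesIn G univ : Set (Sym2 (Fin n))) = G.edgeSet := by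
  ext e
  induction e with | _ a b =>
  simp

lemma coe_colorsIn_univ : (colorsIn G col univ : Set ℕ) = col '' G.edgeSet := by
  rw [colorsIn, coe_image, coe_edgesIn_univ]

lemma eq_top_of_isClique_univ (h : G.IsClique (univ : Finset (Fin n))) : G = ⊤ := by
  ext a b
  exact ⟨fun hab => hab.ne, fun hab => h (by simp) (by simp) hab⟩

lemma isHnr_of_isExtremalOn (hr : 0 < r) (hrn : r < n) {part : Fin n → Fin r} {d : ℕ}
    (hp : IsExtremalOn G col univ part d)
    (hw : weight G col univ = n.choose 2 + turanEdges n r + 1) : IsHnr n r G col := by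
  have htop := eq_top_of_isClique_univ hp.isClique
  have hm := card_edgesIn_of_isClique hp.isClique
  rw [card_univ, Fintype.card_fin] at hm
  let K : SimpleGraph (Fin n) := (⊤ : SimpleGraph (Fin r)).comap part
  have hKadj : ∀ a b, K.Adj a b ↔ part a ≠ part b := fun a b => Iff.rfl
  have hfree : K.CliqueFree (r + 1) := by
    have hcol : K.Colorable r := ⟨⟨part, fun h => h⟩⟩
    exact hcol.cliqueFree (Nat.lt_succ_self r)
  have hinj : Set.InjOn col K.edgeSet := by
    intro e he e' he' hc
    induction e with | _ a b =>
    induction e' with | _ a' b' =>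
    exact hp.inj a (mem_univ _) b (mem_univ _) a' (mem_univ _) b' (mem_univ _) he he' hc
  have hd : d ∉ col '' K.edgeSet := by
    rintro ⟨e, he, hc⟩
    induction e with | _ a b =>
    exact hp.ne a (mem_univ _) b (mem_univ _) he hc
  obtain ⟨x, y, hxy, hpxy⟩ := Fintype.exists_ne_map_eq_of_card_lt part (by simpa using hrn)
  have hcolors : (colorsIn G col univ : Set ℕ) = insert d (col '' K.edgeSet) := by
    rw [coe_colorsIn_univ]
    ext c
    simp only [Set.mem_insert_iff, Set.mem_image]
    constructor
    · rintro ⟨e, he, rfl⟩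
      induction e with | _ a b =>
      by_cases h : part a = part b
      · exact Or.inl (hp.same a (mem_univ _) b (mem_univ _) (G.ne_of_adj he) h)
      · exact Or.inr ⟨s(a, b), h, rfl⟩
    · rintro (rfl | ⟨e, he, rfl⟩)
      · exact ⟨s(x, y), by simp [htop, hxy], hp.same x (mem_univ _) y (mem_univ _) hxy hpxy⟩
      · refine ⟨e, ?_, rfl⟩
        induction e with | _ a b =>
        rw [htop]
        exact K.ne_of_adj he
  have hcard : K.edgeSet.ncard = turanEdges n r := by
    have h1 : #(colorsIn G col univ) = K.edgeSet.ncard + 1 := by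
      rw [← Set.ncard_coe_finset, hcolors, Set.ncard_insert_of_notMem hd, hinj.ncard_image]
    rw [weight] at hw
    omega
  obtain ⟨σ, hσ⟩ := exists_turanCopyEdges_eq K hr hfree hcard
  refine ⟨htop, σ, hσ ▸ hinj, d, ?_, hσ ▸ hd⟩
  rw [hσ]
  intro e hdiag he
  induction e with | _ a b =>
  exact hp.same a (mem_univ _) b (mem_univ _) (by simpa using hdiag) (not_not.1 he)

lemma hasSpanningRainbowTuran_of_matching (hr : 0 < r) (hrn : r ≤ n) (hnr : n ≤ 2 * r)
    {M : Finset (Sym2 (Fin n))} (hcl : G.IsClique (univ : Finset (Fin n)))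
    (hM : M ⊆ edgesIn G univ) (hdisj : ∀ b ∈ M, ∀ b' ∈ M, ∀ v ∈ b, v ∈ b' → b = b')
    (hMr : #M + r = n) (hinj : Set.InjOn col (edgesIn G univ \ M : Finset (Sym2 (Fin n)))) :
    HasSpanningRainbowTuran n r G col := by
  have hm := card_edgesIn_of_isClique hcl
  rw [card_univ, Fintype.card_fin] at hm
  let K : SimpleGraph (Fin n) := G.deleteEdges M
  have hKe : K.edgeSet = (edgesIn G univ \ M : Finset (Sym2 (Fin n))) := by
    rw [coe_sdiff, coe_edgesIn_univ, SimpleGraph.edgeSet_deleteEdges]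
  have hfree : K.CliqueFree (r + 1) := by
    intro s hs
    have hex : ∀ e ∈ M, ∃ v ∈ e, v ∉ s := by
      intro e he
      by_contra! hall
      induction e with | _ a b =>
      have hab := (mk_mem_edgesIn.1 (hM he)).2.ne
      have := hs.isClique (hall a (by simp)) (hall b (by simp)) hab
      rw [SimpleGraph.deleteEdges_adj] at this
      exact this.2 he
    have : Nonempty (Fin n) := ⟨⟨0, by omega⟩⟩
    choose! f hf hfs using hex
    have hcard : #(M.image f) = #M := card_image_of_injOn fun e he e' he' h =>
      hdisj e he e' he' (f e) (hf e he) (h ▸ hf e' he')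
    have hd : Disjoint s (M.image f) := by
      rw [disjoint_left]
      intro v hv hv'
      obtain ⟨e, he, rfl⟩ := mem_image.1 hv'
      exact hfs e he hv
    have := card_le_univ (s ∪ M.image f)
    rw [card_union_of_disjoint hd, hs.card_eq, hcard, Fintype.card_fin] at this
    omega
  have hcard : K.edgeSet.ncard = turanEdges n r := by
    rw [hKe, Set.ncard_coe_finset, card_sdiff_of_subset hM, hm]
    have := turanEdges_add_of_le hrn hnr hr
    omega
  obtain ⟨σ, hσ⟩ := exists_turanCopyEdges_eq K hr hfree hcard
  refine ⟨σ, hσ ▸ SimpleGraph.edgeSet_mono (SimpleGraph.deleteEdges_le _), ?_⟩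
  rw [hσ, hKe]
  exact hinj

end Fin

end RainbowTuran

/-- If `G` is an edge-colored graph on `n ≥ k ≥ 6` vertices with
`m(G) + c(G) = (n choose 2) + t_{n,k-2} + 1` and no rainbow `K_k`, then
`G ∈ ℋ_k`. -/
theorem stmt_8 (n k : ℕ) (hk : 6 ≤ k) (hkn : k ≤ n) (G : SimpleGraph (Fin n))
    (col : Sym2 (Fin n) → ℕ)
    (h : G.edgeSet.ncard + (col '' G.edgeSet).ncard =
      n.choose 2 + turanEdges n (k - 2) + 1)
    (hno : ¬ ∃ s : Finset (Fin n), s.card = k ∧ IsRainbowClique G col s) :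
    HClass n k G col := by
  obtain ⟨r, rfl⟩ : ∃ r, k = r + 2 := ⟨k - 2, by omega⟩
  rw [Nat.add_sub_cancel] at h
  rw [HClass, Nat.add_sub_cancel]
  have hm : G.edgeSet.ncard = (RainbowTuran.edgesIn G Finset.univ).card := by
    rw [← RainbowTuran.coe_edgesIn_univ, Set.ncard_coe_finset]
  have hc : (col '' G.edgeSet).ncard = (RainbowTuran.colorsIn G col Finset.univ).card := by
    rw [← RainbowTuran.coe_colorsIn_univ, Set.ncard_coe_finset]
  have hw : RainbowTuran.weight G col Finset.univ = n.choose 2 + turanEdges n r + 1 := by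
    rw [RainbowTuran.weight, ← hm, ← hc, h]
  have hno' : ¬ ∃ T ⊆ (Finset.univ : Finset (Fin n)), T.card = r + 2 ∧ IsRainbowClique G col T :=
    fun ⟨T, _, hT⟩ => hno ⟨T, hT⟩
  have hn : (Finset.univ : Finset (Fin n)).card = n := by simp
  by_cases hnr : 2 * r ≤ n
  · obtain ⟨part, d, hp⟩ := RainbowTuran.exists_isExtremalOn (r := r) (by omega)
      (by rwa [hn]) hno' (by rwa [hn])
    exact Or.inl (RainbowTuran.isHnr_of_isExtremalOn (by omega) (by omega) hp hw)
  · obtain ⟨hcl, M, hM, hdisj, hMr, hinj, -⟩ := RainbowTuran.exists_matching (r := r) (by omega)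
      (by omega) (by omega) hno' (by rwa [hn])
    rw [hn] at hMr
    have hcard := RainbowTuran.card_edgesIn_of_isClique hcl
    rw [hn] at hcard
    refine Or.inr ⟨?_, RainbowTuran.eq_top_of_isClique_univ hcl, by omega,
      RainbowTuran.hasSpanningRainbowTuran_of_matching (by omega) (by omega) (by omega) hcl hM
        hdisj hMr hinj, hno⟩
    exact Nat.div_eq_of_lt_le (by omega) (by omega)
end

section
/- Let n ≥ k ≥ 6 with ⌊n/(k−2)⌋ ≥ 2, and let G be an edge-colored complete graph on n vertices that contains no rainbow K_k, contains a spanning rainbow copy of the Turán graph T_{n,k−2}, and whose edges are colored with exactly t_{n,k−2} + 1 colors. Then all edges of G joining two vertices inside the same partite set of the rainbow T_{n,k−2} receive one common color, and this color is not used on any edge of the rainbow T_{n,k−2}. -/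
/-- `p` partitions the vertices into parts of size at least two such that the edges between
different parts form a rainbow subgraph, and there is no rainbow clique with two more vertices
than there are parts. -/
structure IsRainbowPartition {V : Type*} {r : ℕ} (col : Sym2 V → ℕ) (p : V → Fin r) : Prop where
  inj : ∀ a b c d, p a ≠ p b → p c ≠ p d → col s(a, b) = col s(c, d) → s(a, b) = s(c, d)
  exists_pair : ∀ i, ∃ x y, x ≠ y ∧ p x = i ∧ p y = i
  no_clique : ¬ ∃ s : Finset V, s.card = r + 2 ∧ IsRainbowClique (⊤ : SimpleGraph V) col s

namespace IsRainbowPartition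

variable {V : Type*} {r : ℕ} {col : Sym2 V → ℕ} {p : V → Fin r}

/-- A transversal together with two further vertices in different parts does not span a rainbow
clique, so one of the two inner edges repeats the color of a cross edge. -/
lemma exists_cross_edge (h : IsRainbowPartition col p) (f : Fin r → V) (hf : ∀ l, p (f l) = l)
    {v y : V} (hv : v ≠ f (p v)) (hy : y ≠ f (p y)) (hvy : p v ≠ p y)
    (hcol : col s(f (p v), v) ≠ col s(f (p y), y)) :
    ∃ a b, p a ≠ p b ∧ (a = f (p a) ∨ a = v ∨ a = y) ∧ (b = f (p b) ∨ b = v ∨ b = y) ∧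
      (col s(a, b) = col s(f (p v), v) ∨ col s(a, b) = col s(f (p y), y)) := by
  classical
  by_contra hcon
  push Not at hcon
  have hmem : ∀ a, a ∈ insert v (insert y (Finset.univ.image f)) ↔
      (a = f (p a) ∨ a = v ∨ a = y) := by
    intro a
    simp only [Finset.mem_insert, Finset.mem_image, Finset.mem_univ, true_and]
    constructor
    · rintro (rfl | rfl | ⟨l, rfl⟩)
      · simp
      · simp
      · simp [hf]
    · rintro (ha | rfl | rfl)
      · exact Or.inr (Or.inr ⟨p a, ha.symm⟩)
      · simp
      · simp
  have hedge : ∀ a b, (a = f (p a) ∨ a = v ∨ a = y) → (b = f (p b) ∨ b = v ∨ b = y) → a ≠ b →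
      p a ≠ p b ∨ s(a, b) = s(f (p v), v) ∨ s(a, b) = s(f (p y), y) := by
    intro a b ha hb hab
    by_cases hp : p a = p b
    · right
      rw [Sym2.eq_iff, Sym2.eq_iff]
      grind
    · exact Or.inl hp
  refine h.no_clique ⟨insert v (insert y (Finset.univ.image f)), ?_, ?_, ?_⟩
  · have hinj : Function.Injective f := fun a b hab => by rw [← hf a, ← hf b, hab]
    rw [Finset.card_insert_of_notMem, Finset.card_insert_of_notMem,
      Finset.card_image_of_injective _ hinj, Finset.card_univ, Fintype.card_fin]
    · simp only [Finset.mem_image, Finset.mem_univ, true_and, not_exists]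
      rintro l rfl
      exact hy (by rw [hf])
    · simp only [Finset.mem_insert, Finset.mem_image, Finset.mem_univ, true_and, not_or,
        not_exists]
      refine ⟨fun e => hvy (by rw [e]), ?_⟩
      rintro l rfl
      exact hv (by rw [hf])
  · intro a _ b _ hab
    simpa using hab
  · intro a ha b hb c hc d hd hab hcd hne heq
    rw [hmem] at ha hb hc hd
    rcases hedge a b ha hb hab with h1 | h1 | h1 <;> rcases hedge c d hc hd hcd with h2 | h2 | h2
    · exact hne (h.inj a b c d h1 h2 heq)
    · exact (hcon a b h1 ha hb).1 (by rw [heq, h2])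
    · exact (hcon a b h1 ha hb).2 (by rw [heq, h2])
    · exact (hcon c d h2 hc hd).1 (by rw [← heq, h1])
    · exact hne (by rw [h1, h2])
    · exact hcol (by rw [← h1, ← h2, heq])
    · exact (hcon c d h2 hc hd).2 (by rw [← heq, h1])
    · exact hcol (by rw [← h1, ← h2, heq])
    · exact hne (by rw [h1, h2])

lemma exists_mem_ne (h : IsRainbowPartition col p) (l : Fin r) (g : V) : ∃ z, p z = l ∧ z ≠ g := by
  obtain ⟨x, y, hxy, hx, hy⟩ := h.exists_pair l
  by_cases hg : x = g
  · exact ⟨y, hy, fun e => hxy (hg.trans e.symm)⟩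
  · exact ⟨x, hx, hg⟩

/-- If the color of an inner edge `uv` is not used on cross edges, then an inner edge `xy` of
another part whose color is used on a cross edge has the color of one between `uv` and `xy`. -/
lemma exists_between (h : IsRainbowPartition col p) {u v x y g g' : V} (huv : u ≠ v)
    (hp : p u = p v) (hxy : x ≠ y) (hq : p x = p y) (hux : p u ≠ p x)
    (hd : ∀ a b, p a ≠ p b → col s(a, b) ≠ col s(u, v))
    (hg : p g ≠ p g') (hcol : col s(x, y) = col s(g, g')) :
    ∃ a b, (a = u ∨ a = v) ∧ (b = x ∨ b = y) ∧ col s(x, y) = col s(a, b) := by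
  by_contra hcon
  push Not at hcon
  have hsec : ∀ l, ∃ z, p z = l ∧ (l = p u → z = u) ∧ (l = p x → z = x) ∧
      (l ≠ p u → l ≠ p x → z ≠ g ∧ z ≠ g') := by
    intro l
    by_cases hl : l = p u
    · exact ⟨u, hl.symm, by grind⟩
    by_cases hl' : l = p x
    · exact ⟨x, hl'.symm, by grind⟩
    by_cases hlg : l = p g
    · obtain ⟨z, hz, hzg⟩ := h.exists_mem_ne l g
      exact ⟨z, hz, by grind⟩
    · obtain ⟨z, hz, hzg⟩ := h.exists_mem_ne l g'
      exact ⟨z, hz, by grind⟩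
  choose f hf hfu hfx hfg using hsec
  have hu : f (p v) = u := hfu _ hp.symm
  have hx : f (p y) = x := hfx _ hq.symm
  obtain ⟨a, b, hab, ha, hb, hc⟩ := h.exists_cross_edge f hf (v := v) (y := y)
    (by rw [hu]; exact huv.symm) (by rw [hx]; exact hxy.symm) (by rwa [← hp, ← hq])
    (by rw [hu, hx, hcol]; exact (hd g g' hg).symm)
  rw [hu, hx] at hc
  rcases hc with hc | hc
  · exact hd a b hab hc
  · have e := h.inj a b g g' hab hg (hc.trans hcol)
    have hmem : ∀ z, (z = g ∨ z = g') → (z = f (p z) ∨ z = v ∨ z = y) →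
        z = u ∨ z = v ∨ z = x ∨ z = y := by
      intro z hz hz'
      by_cases h1 : p z = p u
      · have := hfu _ h1
        grind
      by_cases h2 : p z = p x
      · have := hfx _ h2
        grind
      have := hfg _ h1 h2
      grind
    have hag : (a = g ∨ a = g') ∧ (b = g ∨ b = g') := by
      rw [Sym2.eq_iff] at e
      grind
    have h1 := hcon a b
    have h2 := hcon b a
    rw [Sym2.eq_swap (a := b) (b := a), hc] at h2
    have h3 := hmem a hag.1 ha
    have h4 := hmem b hag.2 hb
    grind

/-- Two inner edges of different parts cannot both have the color of a cross edge leaving their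
part towards the same vertex of a third part. -/
lemma false_of_common_endpoint (h : IsRainbowPartition col p) {a x y z w b b' : V}
    (hxy : x ≠ y) (hq : p x = p y) (hzw : z ≠ w) (hs : p z = p w) (hax : p a ≠ p x)
    (haz : p a ≠ p z) (hxz : p x ≠ p z) (hb : b = x ∨ b = y) (hb' : b' = z ∨ b' = w)
    (h1 : col s(x, y) = col s(a, b)) (h2 : col s(z, w) = col s(a, b')) : False := by
  have hpb : p b = p x := by grind
  have hpb' : p b' = p z := by grind
  have hsec : ∀ l, ∃ t, p t = l ∧ (l = p a → t ≠ a) ∧ (l = p x → t = x) ∧ (l = p z → t = z) := by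
    intro l
    by_cases hl : l = p x
    · exact ⟨x, hl.symm, by grind⟩
    by_cases hl' : l = p z
    · exact ⟨z, hl'.symm, by grind⟩
    obtain ⟨t, ht, hta⟩ := h.exists_mem_ne l a
    exact ⟨t, ht, by grind⟩
  choose f hf hfa hfx hfz using hsec
  have hx : f (p y) = x := hfx _ hq.symm
  have hz : f (p w) = z := hfz _ hs.symm
  have hne := hfa _ rfl
  obtain ⟨c, d, hcd, hc, hd, hcol⟩ := h.exists_cross_edge f hf (v := y) (y := w)
    (by rw [hx]; exact hxy.symm) (by rw [hz]; exact hzw.symm) (by rwa [← hq, ← hs])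
    (by
      rw [hx, hz, h1, h2]
      intro e
      have := h.inj a b a b' (by grind) (by grind) e
      rw [Sym2.eq_iff] at this
      grind)
  rw [hx, hz, h1, h2] at hcol
  have hca : c = a ∨ d = a := by
    rcases hcol with e | e
    · have := h.inj c d a b hcd (by grind) e
      rw [Sym2.eq_iff] at this
      grind
    · have := h.inj c d a b' hcd (by grind) e
      rw [Sym2.eq_iff] at this
      grind
  grind

/-- If `d` is the only color not used on cross edges and it occurs on an inner
edge `uv`, then every inner edge of any other part has color `d`. -/
lemma col_eq_of_part_ne (h : IsRainbowPartition col p) (hr : 4 ≤ r) {u v x y : V} {d : ℕ}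
    (hd : ∀ a b, p a ≠ p b → col s(a, b) ≠ d)
    (hall : ∀ a b, a ≠ b → col s(a, b) ≠ d → ∃ g g', p g ≠ p g' ∧ col s(a, b) = col s(g, g'))
    (huv : u ≠ v) (hp : p u = p v) (huvd : col s(u, v) = d)
    (hxy : x ≠ y) (hq : p x = p y) (hux : p u ≠ p x) : col s(x, y) = d := by
  by_contra hxyd
  have bad : ∀ {x y : V}, x ≠ y → p x = p y → p u ≠ p x → col s(x, y) ≠ d →
      ∃ a b, (a = u ∨ a = v) ∧ (b = x ∨ b = y) ∧ col s(x, y) = col s(a, b) := by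
    intro x y hxy hq hux hxyd
    obtain ⟨g, g', hg, hgc⟩ := hall x y hxy hxyd
    exact h.exists_between huv hp hxy hq hux (by rwa [huvd]) hg hgc
  obtain ⟨a, b, ha, hb, hab⟩ := bad hxy hq hux hxyd
  have other : ∀ {z w : V}, z ≠ w → p z = p w → p u ≠ p z → p x ≠ p z → col s(z, w) ≠ d := by
    intro z w hzw hs huz hxz hzwd
    obtain ⟨a', b', ha', hb', hab'⟩ := h.exists_between hzw hs hxy hq hxz.symm (by rwa [hzwd])
      (g := a) (g' := b) (by grind) hab
    have := h.inj a b a' b' (by grind) (by grind) (hab.symm.trans hab')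
    rw [Sym2.eq_iff] at this
    grind
  obtain ⟨l, hl⟩ : ∃ l, l ∉ ({p u, p x} : Finset (Fin r)) := by
    by_contra! hcon
    have h1 := Finset.card_le_card (fun l _ => hcon l : (Finset.univ : Finset (Fin r)) ⊆ _)
    have h2 := Finset.card_le_two (a := p u) (b := p x)
    rw [Finset.card_univ, Fintype.card_fin] at h1
    omega
  obtain ⟨m, hm⟩ : ∃ m, m ∉ ({p u, p x, l} : Finset (Fin r)) := by
    by_contra! hcon
    have h1 := Finset.card_le_card (fun l _ => hcon l : (Finset.univ : Finset (Fin r)) ⊆ _)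
    have h2 := Finset.card_le_three (a := p u) (b := p x) (c := l)
    rw [Finset.card_univ, Fintype.card_fin] at h1
    omega
  simp only [Finset.mem_insert, Finset.mem_singleton, not_or] at hl hm
  obtain ⟨z, w, hzw, rfl, hs⟩ := h.exists_pair l
  obtain ⟨z', w', hzw', rfl, hs'⟩ := h.exists_pair m
  obtain ⟨a₁, b₁, ha₁, hb₁, hab₁⟩ := bad hzw hs.symm (Ne.symm hl.1)
    (other hzw hs.symm (Ne.symm hl.1) (Ne.symm hl.2))
  obtain ⟨a₂, b₂, ha₂, hb₂, hab₂⟩ := bad hzw' hs'.symm (Ne.symm hm.1)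
    (other hzw' hs'.symm (Ne.symm hm.1) (Ne.symm hm.2.1))
  have hpa : p a = p u := by grind
  have hpa₁ : p a₁ = p u := by grind
  obtain e | e | e : a = a₁ ∨ a = a₂ ∨ a₁ = a₂ := by grind
  · subst e
    exact h.false_of_common_endpoint hxy hq hzw hs.symm (by grind) (by grind) (by grind)
      hb hb₁ hab hab₁
  · subst e
    exact h.false_of_common_endpoint hxy hq hzw' hs'.symm (by grind) (by grind) (by grind)
      hb hb₂ hab hab₂
  · subst e
    exact h.false_of_common_endpoint hzw hs.symm hzw' hs'.symm (by grind) (by grind) (by grind)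
      hb₁ hb₂ hab₁ hab₂

/-- If `d` is the only color not used on cross edges and it occurs on an inner edge, then all inner
edges have color `d`. -/
lemma col_eq (h : IsRainbowPartition col p) (hr : 4 ≤ r) {u v x y : V} {d : ℕ}
    (hd : ∀ a b, p a ≠ p b → col s(a, b) ≠ d)
    (hall : ∀ a b, a ≠ b → col s(a, b) ≠ d → ∃ g g', p g ≠ p g' ∧ col s(a, b) = col s(g, g'))
    (huv : u ≠ v) (hp : p u = p v) (huvd : col s(u, v) = d)
    (hxy : x ≠ y) (hq : p x = p y) : col s(x, y) = d := by
  by_cases hux : p u = p x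
  · have : Nontrivial (Fin r) := Fin.nontrivial_iff_two_le.2 (by omega)
    obtain ⟨l, hl⟩ := exists_ne (p u)
    obtain ⟨z, w, hzw, rfl, hs⟩ := h.exists_pair l
    have hzwd := h.col_eq_of_part_ne hr hd hall huv hp huvd hzw hs.symm hl.symm
    exact h.col_eq_of_part_ne hr hd hall hzw hs.symm hzwd hxy hq (by rwa [← hux])
  · exact h.col_eq_of_part_ne hr hd hall huv hp huvd hxy hq hux

end IsRainbowPartition

lemma mk_mem_turanCopyEdges {n r : ℕ} {σ : Fin n ≃ Fin n} {a b : Fin n} :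
    s(a, b) ∈ turanCopyEdges n r σ ↔ (σ a : ℕ) % r ≠ (σ b : ℕ) % r := by
  simp [turanCopyEdges, SimpleGraph.turanGraph]

lemma ncard_turanCopyEdges (n r : ℕ) (σ : Fin n ≃ Fin n) :
    (turanCopyEdges n r σ).ncard = turanEdges n r := by
  refine Set.ncard_preimage_of_injective_subset_range (f := Sym2.map σ)
    (Sym2.map.injective σ.injective) fun e _ => ⟨e.map σ.symm, ?_⟩
  simp [Sym2.map_map]

/-- Let `n ≥ k ≥ 6` with `⌊n/(k-2)⌋ ≥ 2`, and let the complete graph on `n`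
vertices be edge-colored with exactly `t_{n,k-2} + 1` colors so that it has no
rainbow `K_k` and contains a spanning rainbow copy of `T_{n,k-2}` (given by the
relabelling `σ`). Then all edges inside partite sets of that rainbow copy
receive one common color, which is not used on the copy itself. -/
theorem stmt_9 (n k : ℕ) (hk : 6 ≤ k) (hkn : k ≤ n) (hfloor : 2 ≤ n / (k - 2))
    (col : Sym2 (Fin n) → ℕ)
    (hno : ¬ ∃ s : Finset (Fin n), s.card = k ∧
      IsRainbowClique (⊤ : SimpleGraph (Fin n)) col s)
    (hc : (col '' (⊤ : SimpleGraph (Fin n)).edgeSet).ncard =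
      turanEdges n (k - 2) + 1)
    (σ : Fin n ≃ Fin n)
    (hrb : Set.InjOn col (turanCopyEdges n (k - 2) σ)) :
    ∃ d, (∀ e : Sym2 (Fin n), ¬ e.IsDiag →
        e ∉ turanCopyEdges n (k - 2) σ → col e = d) ∧
      d ∉ col '' turanCopyEdges n (k - 2) σ := by
  have hr : 4 ≤ k - 2 := by omega
  have hr0 : 0 < k - 2 := by omega
  have hsize : 2 * (k - 2) ≤ n := (Nat.le_div_iff_mul_le hr0).1 hfloor
  let p : Fin n → Fin (k - 2) := fun v => ⟨(σ v : ℕ) % (k - 2), Nat.mod_lt _ hr0⟩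
  have hcross : ∀ a b, s(a, b) ∈ turanCopyEdges n (k - 2) σ ↔ p a ≠ p b := by
    intro a b
    simp [mk_mem_turanCopyEdges, p, Fin.ext_iff]
  have hpart : IsRainbowPartition col p :=
    { inj := fun a b c d hab hcd e => hrb ((hcross a b).2 hab) ((hcross c d).2 hcd) e
      exists_pair := by
        intro i
        refine ⟨σ.symm ⟨i, by omega⟩, σ.symm ⟨i + (k - 2), by omega⟩, ?_, ?_, ?_⟩
        · simp only [ne_eq, EmbeddingLike.apply_eq_iff_eq, Fin.mk.injEq]
          omega
        · simp [p, Nat.mod_eq_of_lt i.isLt]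
        · simp [p, Nat.mod_eq_of_lt i.isLt]
      no_clique := by
        rwa [show k - 2 + 2 = k by omega] }
  have hsub : col '' turanCopyEdges n (k - 2) σ ⊆ col '' (⊤ : SimpleGraph (Fin n)).edgeSet := by
    refine Set.image_mono fun e => ?_
    induction e with | _ a b =>
    rw [hcross, SimpleGraph.mem_edgeSet, SimpleGraph.top_adj]
    exact fun hab e => hab (by rw [e])
  obtain ⟨d, hdiff⟩ : ∃ d, col '' (⊤ : SimpleGraph (Fin n)).edgeSet \
      col '' turanCopyEdges n (k - 2) σ = {d} := by
    rw [← Set.ncard_eq_one, Set.ncard_sdiff hsub (Set.toFinite _), hc, hrb.ncard_image,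
      ncard_turanCopyEdges]
    omega
  have hdmem := hdiff.symm ▸ Set.mem_singleton d
  have hd : ∀ a b, p a ≠ p b → col s(a, b) ≠ d := fun a b hab e =>
    hdmem.2 ⟨s(a, b), (hcross a b).2 hab, e⟩
  have hall : ∀ a b, a ≠ b → col s(a, b) ≠ d →
      ∃ g g', p g ≠ p g' ∧ col s(a, b) = col s(g, g') := by
    intro a b hab hne
    by_contra! hcon
    have : col s(a, b) ∈ ({d} : Set ℕ) := by
      rw [← hdiff]
      refine ⟨⟨s(a, b), by simpa using hab, rfl⟩, ?_⟩
      rintro ⟨e, he, hcol⟩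
      induction e with | _ g g' =>
      exact hcon g g' ((hcross g g').1 he) hcol.symm
    exact hne this
  obtain ⟨e₀, he₀, hcol₀⟩ := hdmem.1
  induction e₀ with | _ u v =>
  refine ⟨d, fun e hdiag he => ?_, hdmem.2⟩
  induction e with | _ x y =>
  rw [hcross, not_not] at he
  exact hpart.col_eq hr hd hall (by simpa using he₀)
    (not_not.1 fun huv => hd u v huv hcol₀) hcol₀ (by simpa using hdiag) he
end
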